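/- arXiv:1904.13043 — 8 statements merged into one kernel-verified Lean document; each statement's English description precedes it below -/
import Mathlib

section
/- There is an absolute constant A such that for every integer k ≥ 2 and every k-Fourier-sparse signal g(t) = ∑_{j=1}^k v_j·exp(2πi·f_j·t), one has sup_{x ∈ [−1,1]} |g(x)|² ≤ A · k³ · (log k)² · ‖g‖₂². (In other words, the ratio R between the maximum and average squared value of continuous k-Fourier-sparse signals on [−1,1] is O(k³ log² k).) -/
open Real MeasureTheory

section ExponentialSum

open Filter Topology Set

variable {ι : Type*}

/-- The exponential sum `∑ j ∈ S, v j * exp (w j * t)` with complex exponents. -/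
noncomputable def exponentialSum (S : Finset ι) (v w : ι → ℂ) (t : ℝ) : ℂ :=
  ∑ j ∈ S, v j * Complex.exp (w j * t)

lemma continuous_exponentialSum (S : Finset ι) (v w : ι → ℂ) :
    Continuous (exponentialSum S v w) := by
  unfold exponentialSum
  fun_prop

lemma hasDerivAt_exponentialSum (S : Finset ι) (v w : ι → ℂ) (t : ℝ) :
    HasDerivAt (exponentialSum S v w) (exponentialSum S (fun j => v j * w j) w t) t := by
  unfold exponentialSum
  refine HasDerivAt.fun_sum fun j _ => ?_
  have h : HasDerivAt (fun t : ℝ => w j * (t : ℂ)) (w j) t := by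
    simpa using (Complex.ofRealCLM.hasDerivAt (x := t)).const_mul (w j)
  simpa [mul_assoc, mul_comm, mul_left_comm] using h.cexp.const_mul (v j)

lemma integrableOn_norm_sq_exponentialSum {S : Finset ι} (v : ι → ℂ) {w : ι → ℂ}
    (hw : ∀ j ∈ S, (w j).re < 0) (c : ℝ) :
    IntegrableOn (fun t => ‖exponentialSum S v w t‖ ^ 2) (Ioi c) := by
  have hmem : MemLp (exponentialSum S v w) 2 (volume.restrict (Ioi c)) := by
    unfold exponentialSum
    refine memLp_finsetSum S fun j hj => MemLp.const_mul ?_ (v j)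
    rw [memLp_two_iff_integrable_sq_norm (by fun_prop)]
    have := integrableOn_exp_mul_Ioi (a := 2 * (w j).re) (by linarith [hw j hj]) c
    refine this.congr (ae_of_all _ fun t => ?_)
    simp only [Complex.norm_exp, ← Real.exp_nat_mul]
    simp [mul_assoc]
  exact (memLp_two_iff_integrable_sq_norm
    (continuous_exponentialSum S v w).aestronglyMeasurable).1 hmem

lemma tendsto_exponentialSum_atTop {S : Finset ι} (v : ι → ℂ) {w : ι → ℂ}
    (hw : ∀ j ∈ S, (w j).re < 0) :
    Tendsto (exponentialSum S v w) atTop (𝓝 0) := by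
  unfold exponentialSum
  rw [← Finset.sum_const_zero (s := S)]
  refine tendsto_finsetSum S fun j hj => ?_
  rw [← mul_zero (v j)]
  refine Tendsto.const_mul (v j) ?_
  rw [tendsto_zero_iff_norm_tendsto_zero]
  simp only [Complex.norm_exp]
  refine Real.tendsto_exp_atBot.comp ?_
  simpa using tendsto_id.const_mul_atTop_of_neg (hw j hj)

lemma sq_le_add_mul_add {f x y p s J : ℝ} (hf : 0 ≤ f) (hp : 0 ≤ p)
    (hs : 0 ≤ s) (hJ : 0 ≤ J) (hfxy : f ≤ x + p * y) (hxs : x ^ 2 ≤ s * J) :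
    f ^ 2 ≤ (p + s) * (J + p * y ^ 2) := by
  have hcross : 2 * x * y ≤ s * y ^ 2 + J := by
    refine abs_le_of_sq_le_sq' ?_ (by positivity) |>.2
    nlinarith [sq_nonneg (s * y ^ 2 - J), mul_le_mul_of_nonneg_right hxs (sq_nonneg y)]
  calc f ^ 2 ≤ (x + p * y) ^ 2 := by gcongr
    _ = x ^ 2 + p * (2 * x * y) + p ^ 2 * y ^ 2 := by ring
    _ ≤ s * J + p * (s * y ^ 2 + J) + p ^ 2 * y ^ 2 := by gcongr
    _ = (p + s) * (J + p * y ^ 2) := by ring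

/-- Point evaluation at `0` on the span of finitely many decaying exponentials has squared norm
at most `∑ j, -2 * re (w j)` with respect to the `L²` norm on the half line. -/
theorem norm_sq_exponentialSum_zero_le (S : Finset ι) (v w : ι → ℂ)
    (hw : ∀ j ∈ S, (w j).re < 0) :
    ‖exponentialSum S v w 0‖ ^ 2 ≤
      (∑ j ∈ S, -2 * (w j).re) * ∫ t in Ioi (0 : ℝ), ‖exponentialSum S v w t‖ ^ 2 := by
  classical
  induction S using Finset.induction_on generalizing v with
  | empty => simp [exponentialSum]
  | insert a S ha ih =>
    have hwS : ∀ j ∈ S, (w j).re < 0 := fun j hj => hw j (Finset.mem_insert_of_mem hj)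
    have hwa : (w a).re < 0 := hw a (Finset.mem_insert_self a S)
    set p : ℝ := -2 * (w a).re with hp
    have hp0 : 0 < p := by rw [hp]; linarith
    set c : ι → ℂ := fun j => v j / (w j + (starRingEnd ℂ) (w a)) with hc
    set b : ι → ℂ := fun j => c j * (w j - w a) with hb
    set F := exponentialSum (insert a S) v w with hF
    set U := exponentialSum (insert a S) c w with hU
    set H := exponentialSum S b w with hH
    have hden : ∀ j ∈ insert a S, w j + (starRingEnd ℂ) (w a) ≠ 0 := fun j hj h => by
      have := congrArg Complex.re h
      simp only [Complex.add_re, Complex.conj_re, Complex.zero_re] at this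
      linarith [hw j hj]
    have hderF : ∀ t, exponentialSum (insert a S) (fun j => c j * w j) w t
        = F t - (starRingEnd ℂ) (w a) * U t := fun t => by
      simp only [hF, hU, exponentialSum, Finset.mul_sum, ← Finset.sum_sub_distrib]
      refine Finset.sum_congr rfl fun j hj => ?_
      have := hden j hj
      simp only [hc]
      field_simp
      ring
    have hderH : ∀ t, exponentialSum (insert a S) (fun j => c j * w j) w t
        = H t + w a * U t := fun t => by
      have : H t = exponentialSum (insert a S) b w t := by
        simp [hH, exponentialSum, Finset.sum_insert ha, hb]
      rw [this]
      simp only [hU, exponentialSum, Finset.mul_sum, ← Finset.sum_add_distrib]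
      refine Finset.sum_congr rfl fun j _ => ?_
      simp only [hb]
      ring
    have hFH : ∀ t, F t = H t - p * U t := fun t => by
      have h1 := (hderF t).symm.trans (hderH t)
      have h2 : w a + (starRingEnd ℂ) (w a) = -(p : ℂ) := by
        rw [Complex.add_conj, hp]; push_cast; ring
      linear_combination h1 + h2 * U t
    have hder : ∀ t ∈ Ici (0 : ℝ),
        HasDerivAt (fun t => p * ‖U t‖ ^ 2) (‖H t‖ ^ 2 - ‖F t‖ ^ 2) t := fun t _ => by
      refine (((hasDerivAt_exponentialSum (insert a S) c w t).norm_sq).const_mul p).congr_deriv ?_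
      rw [hderH, hFH, Complex.inner, ← Complex.normSq_eq_norm_sq, ← Complex.normSq_eq_norm_sq]
      simp only [Complex.normSq_apply, ← hU, Complex.mul_re, Complex.mul_im, Complex.conj_re,
        Complex.conj_im, Complex.add_re, Complex.add_im, Complex.sub_re, Complex.sub_im,
        Complex.ofReal_re, Complex.ofReal_im, hp]
      ring
    have hintF := integrableOn_norm_sq_exponentialSum v hw 0
    have hintH := integrableOn_norm_sq_exponentialSum b hwS 0
    have hlim : Tendsto (fun t => p * ‖U t‖ ^ 2) atTop (𝓝 0) := by
      simpa using ((tendsto_exponentialSum_atTop c hw).norm.pow 2).const_mul p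
    have hint := integral_Ioi_of_hasDerivAt_of_tendsto' hder (hintH.sub hintF) hlim
    rw [integral_sub hintH hintF] at hint
    have ih' := ih b hwS
    rw [Finset.sum_insert ha, ← hp]
    set s := ∑ j ∈ S, -2 * (w j).re
    have hs : 0 ≤ s := Finset.sum_nonneg fun j hj => by linarith [hwS j hj]
    set I := ∫ t in Ioi (0 : ℝ), ‖F t‖ ^ 2
    set J := ∫ t in Ioi (0 : ℝ), ‖H t‖ ^ 2
    have hI : I = J + p * ‖U 0‖ ^ 2 := by linarith
    have htri : ‖F 0‖ ≤ ‖H 0‖ + p * ‖U 0‖ := by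
      rw [hFH]
      refine (norm_sub_le _ _).trans (le_of_eq ?_)
      rw [norm_mul, Complex.norm_real, Real.norm_of_nonneg hp0.le]
    have hJ : 0 ≤ J := integral_nonneg fun t => sq_nonneg _
    rw [hI]
    exact sq_le_add_mul_add (norm_nonneg _) hp0.le hs hJ htri ih'

/-- A sum of `k` purely oscillating exponentials satisfies a linear recurrence with coefficients
of total size `2 ^ k`, so a bound at the `k` preceding nodes propagates. -/
lemma norm_exponentialSum_le_of_nodes {S : Finset ι} (v : ι → ℂ) {w : ι → ℂ} {y h B : ℝ}
    (hw : ∀ j ∈ S, (w j).re = 0) (hB0 : 0 ≤ B)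
    (hB : ∀ n : ℕ, 1 ≤ n → n ≤ S.card → ‖exponentialSum S v w (y - n * h)‖ ≤ B) :
    ‖exponentialSum S v w y‖ ≤ 2 ^ S.card * B := by
  classical
  set d : Finset ι → ℂ := fun T => (-1) ^ T.card * ∏ i ∈ T, Complex.exp (w i * h) with hd
  have hdnorm : ∀ T ∈ S.powerset, ‖d T‖ = 1 := fun T hT => by
    rw [hd, norm_mul, norm_pow, norm_neg, norm_one, one_pow, one_mul, norm_prod]
    refine Finset.prod_eq_one fun i hi => ?_
    simp [Complex.norm_exp, hw i (Finset.mem_powerset.1 hT hi)]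
  have hsum : ∑ T ∈ S.powerset, d T * exponentialSum S v w (y - T.card * h) = 0 := by
    simp only [exponentialSum, Finset.mul_sum]
    rw [Finset.sum_comm]
    refine Finset.sum_eq_zero fun j hj => ?_
    have hprod : ∏ i ∈ S, (1 - Complex.exp (w i * h) * Complex.exp (-(w j * h))) = 0 := by
      refine Finset.prod_eq_zero hj ?_
      rw [← Complex.exp_add]
      simp
    calc _ = v j * Complex.exp (w j * y) *
          ∏ i ∈ S, (1 - Complex.exp (w i * h) * Complex.exp (-(w j * h))) := by
          simp only [sub_eq_add_neg]
          rw [Finset.prod_one_add, Finset.mul_sum]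
          refine Finset.sum_congr rfl fun T _ => ?_
          rw [Finset.prod_neg, Finset.prod_mul_distrib, Finset.prod_const, ← Complex.exp_nat_mul]
          have : Complex.exp (w j * ((y - T.card * h : ℝ) : ℂ)) =
              Complex.exp (w j * y) * Complex.exp (T.card * -(w j * h)) := by
            rw [← Complex.exp_add]; push_cast; ring_nf
          rw [← sub_eq_add_neg, this]
          simp only [hd]
          ring
      _ = 0 := by rw [hprod, mul_zero]
  rw [← Finset.sum_erase_add _ _ (Finset.empty_mem_powerset S)] at hsum
  have h0 : exponentialSum S v w y =
      -∑ T ∈ S.powerset.erase ∅, d T * exponentialSum S v w (y - T.card * h) := by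
    rw [eq_neg_iff_add_eq_zero, add_comm, ← hsum]
    simp [hd]
  rw [h0, norm_neg]
  calc _ ≤ ∑ T ∈ S.powerset.erase ∅, B := by
        refine norm_sum_le_of_le _ fun T hT => ?_
        obtain ⟨hT0, hTS⟩ := Finset.mem_erase.1 hT
        rw [norm_mul, hdnorm T hTS, one_mul]
        exact hB _ (Finset.card_pos.2 (Finset.nonempty_iff_ne_empty.2 hT0))
          (Finset.card_le_card (Finset.mem_powerset.1 hTS))
    _ ≤ ∑ T ∈ S.powerset, B :=
        Finset.sum_le_sum_of_subset_of_nonneg (Finset.erase_subset _ _) fun _ _ _ => hB0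
    _ = 2 ^ S.card * B := by simp

/-- Exponential growth of a purely oscillating sum beyond an interval of length one on which it is
bounded. -/
lemma norm_exponentialSum_le_exp {S : Finset ι} (v : ι → ℂ) {w : ι → ℂ} {B : ℝ}
    (hS : S.Nonempty) (hw : ∀ j ∈ S, (w j).re = 0)
    (hB : ∀ t ∈ Icc (0 : ℝ) 1, ‖exponentialSum S v w t‖ ≤ B) {t : ℝ} (ht : 1 ≤ t) :
    ‖exponentialSum S v w t‖ ≤ B * Real.exp ((S.card : ℝ) ^ 2 * t) := by
  have hB0 : 0 ≤ B := (norm_nonneg _).trans (hB 0 (by simp))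
  set k : ℕ := S.card with hk
  have hk1 : (1 : ℝ) ≤ k := by exact_mod_cast hS.card_pos
  have hk0 : (0 : ℝ) < k := by linarith
  have hstep : ∀ m : ℕ, ∀ y ∈ Icc (0 : ℝ) (1 + m / k),
      ‖exponentialSum S v w y‖ ≤ (2 ^ k) ^ m * B := by
    intro m
    induction m with
    | zero => simpa using hB
    | succ m ih =>
      intro y hy
      have hpow : (1 : ℝ) ≤ 2 ^ k := one_le_pow₀ (by norm_num)
      rcases le_total y (1 + m / k) with h | h
      · refine (ih y ⟨hy.1, h⟩).trans ?_
        gcongr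
        simp
      · rw [pow_succ', mul_assoc]
        refine norm_exponentialSum_le_of_nodes (h := 1 / k) v hw (by positivity)
          fun n hn1 hnk => ih _ ⟨?_, ?_⟩
        · have h1 : (n : ℝ) * (1 / k) ≤ 1 := by
            rw [mul_one_div, div_le_one hk0]
            exact_mod_cast hnk
          have : (0 : ℝ) ≤ m / k := by positivity
          linarith
        · have h1 : (1 : ℝ) / k ≤ n * (1 / k) :=
            le_mul_of_one_le_left (by positivity) (by exact_mod_cast hn1)
          have h2 := hy.2
          push_cast at h2
          rw [add_div] at h2
          linarith
  set m : ℕ := ⌈k * (t - 1)⌉₊ with hm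
  have hm1 : k * (t - 1) ≤ m := Nat.le_ceil _
  have hm2 : (m : ℝ) < k * (t - 1) + 1 := Nat.ceil_lt_add_one (by nlinarith)
  refine (hstep m t ⟨by linarith, ?_⟩).trans ?_
  · have : t - 1 ≤ m / k := by rw [le_div_iff₀ hk0]; linarith
    linarith
  · rw [mul_comm]
    gcongr
    calc ((2 : ℝ) ^ k) ^ m ≤ (Real.exp 1 ^ k) ^ m := by
          gcongr
          linarith [Real.add_one_le_exp (1 : ℝ)]
      _ = Real.exp (k * m) := by
          rw [← pow_mul, ← Real.exp_nat_mul]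
          simp
      _ ≤ Real.exp ((k : ℝ) ^ 2 * t) := by
          refine Real.exp_le_exp.2 ?_
          nlinarith

/-- Evaluation of a purely oscillating sum at the left endpoint of an interval of length one on
which the endpoint is the maximum. -/
theorem norm_sq_exponentialSum_zero_le_of_isMax {S : Finset ι} (v : ι → ℂ) {w : ι → ℂ}
    (hw : ∀ j ∈ S, (w j).re = 0)
    (hmax : ∀ t ∈ Icc (0 : ℝ) 1, ‖exponentialSum S v w t‖ ≤ ‖exponentialSum S v w 0‖) :
    ‖exponentialSum S v w 0‖ ^ 2 ≤
      8 * (S.card : ℝ) ^ 3 * ∫ t in (0 : ℝ)..1, ‖exponentialSum S v w t‖ ^ 2 := by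
  rcases S.eq_empty_or_nonempty with rfl | hS
  · simp [exponentialSum]
  set k : ℝ := (S.card : ℝ) with hk
  have hk1 : 1 ≤ k := by rw [hk]; exact_mod_cast hS.card_pos
  have hk0 : 0 < k := by linarith
  set G := exponentialSum S v w with hG
  set M := ‖G 0‖ with hM
  set u : ι → ℂ := fun j => w j - ((2 * k ^ 2 : ℝ) : ℂ) with hu
  have hure : ∀ j ∈ S, (u j).re = -(2 * k ^ 2) := fun j hj => by
    simp only [hu, Complex.sub_re, hw j hj, Complex.ofReal_re, zero_sub]
  have huneg : ∀ j ∈ S, (u j).re < 0 := fun j hj => by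
    rw [hure j hj]
    have : 0 < k ^ 2 := by positivity
    linarith
  have hE : ∀ t, exponentialSum S v u t = Real.exp (-(2 * k ^ 2) * t) * G t := fun t => by
    simp only [hG, exponentialSum, Finset.mul_sum]
    refine Finset.sum_congr rfl fun j _ => ?_
    rw [Complex.ofReal_exp, mul_left_comm, ← Complex.exp_add]
    simp only [hu]
    push_cast
    ring_nf
  have hEsq : ∀ t, ‖exponentialSum S v u t‖ ^ 2 = Real.exp (-(4 * k ^ 2) * t) * ‖G t‖ ^ 2 :=
    fun t => by
      rw [hE, norm_mul, mul_pow, Complex.norm_real, Real.norm_of_nonneg (Real.exp_pos _).le,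
        ← Real.exp_nat_mul]
      congr 2
      push_cast
      ring
  have hmain := norm_sq_exponentialSum_zero_le S v u huneg
  have hint := integrableOn_norm_sq_exponentialSum v huneg
  have hsum : ∑ j ∈ S, -2 * (u j).re = 4 * k ^ 3 := by
    rw [Finset.sum_congr rfl fun j hj => by rw [hure j hj], Finset.sum_const, nsmul_eq_mul, ← hk]
    ring
  have hcont := continuous_exponentialSum S v w
  rw [hsum, hEsq 0, mul_zero, Real.exp_zero, one_mul, ← hM,
    ← intervalIntegral.integral_interval_add_Ioi (b := 1) (hint 0) (hint 1)] at hmain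
  have hhead : ∫ t in (0 : ℝ)..1, ‖exponentialSum S v u t‖ ^ 2 ≤
      ∫ t in (0 : ℝ)..1, ‖G t‖ ^ 2 := by
    refine intervalIntegral.integral_mono_on zero_le_one
      (((continuous_exponentialSum S v u).norm.pow 2).intervalIntegrable _ _)
      ((hcont.norm.pow 2).intervalIntegrable _ _) fun t ht => ?_
    rw [hEsq]
    refine mul_le_of_le_one_left (sq_nonneg _) (Real.exp_le_one_iff.2 ?_)
    have : 0 ≤ k ^ 2 * t := mul_nonneg (sq_nonneg _) ht.1
    linarith
  have hneg : -(2 * k ^ 2) < 0 := by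
    have : 0 < k ^ 2 := by positivity
    linarith
  have htail : ∫ t in Ioi (1 : ℝ), ‖exponentialSum S v u t‖ ^ 2 ≤
      M ^ 2 * (Real.exp (-(2 * k ^ 2)) / (2 * k ^ 2)) := by
    calc _ ≤ ∫ t in Ioi (1 : ℝ), M ^ 2 * Real.exp (-(2 * k ^ 2) * t) := by
          refine setIntegral_mono_on (hint 1) ((integrableOn_exp_mul_Ioi hneg 1).const_mul _)
            measurableSet_Ioi fun t ht => ?_
          have hgrow := norm_exponentialSum_le_exp v hS hw hmax (le_of_lt ht)
          rw [hEsq]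
          calc _ ≤ Real.exp (-(4 * k ^ 2) * t) * (M * Real.exp (k ^ 2 * t)) ^ 2 := by
                gcongr
            _ = M ^ 2 * Real.exp (-(2 * k ^ 2) * t) := by
                rw [mul_pow, ← Real.exp_nat_mul, mul_left_comm, ← Real.exp_add]
                congr 2
                push_cast
                ring
      _ = _ := by
          rw [integral_const_mul, integral_exp_mul_Ioi hneg, mul_one, neg_div_neg_eq]
  have hsmall : 4 * k ^ 3 * (M ^ 2 * (Real.exp (-(2 * k ^ 2)) / (2 * k ^ 2))) ≤ M ^ 2 / 2 := by
    have h1 : 4 * k ≤ Real.exp (2 * k ^ 2) := by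
      have := Real.quadratic_le_exp_of_nonneg (x := 2 * k ^ 2) (by positivity)
      nlinarith [sq_nonneg (k - 1), sq_nonneg (k ^ 2 - 1)]
    have h2 : k * Real.exp (-(2 * k ^ 2)) ≤ 1 / 4 := by
      rw [Real.exp_neg, ← div_eq_mul_inv, div_le_iff₀ (Real.exp_pos _)]
      linarith
    calc _ = 2 * M ^ 2 * (k * Real.exp (-(2 * k ^ 2))) := by
          field_simp
          ring
      _ ≤ 2 * M ^ 2 * (1 / 4) := by gcongr
      _ = M ^ 2 / 2 := by ring
  have h1 := mul_le_mul_of_nonneg_left hhead (by positivity : 0 ≤ 4 * k ^ 3)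
  have h2 := mul_le_mul_of_nonneg_left htail (by positivity : 0 ≤ 4 * k ^ 3)
  linarith

end ExponentialSum

/-- For some absolute constant `A`, every `k`-Fourier-sparse signal
(`k ≥ 2`) satisfies `sup_{x ∈ [-1,1]} |g x|² ≤ A k³ (log k)² ‖g‖₂²`, where
`‖g‖₂² = (1/2) ∫_{-1}^{1} |g|²`. -/
theorem sparse_sup_bound :
    ∃ A : ℝ, 0 < A ∧
      ∀ (k : ℕ), 2 ≤ k →
        ∀ (v : ℕ → ℂ) (f : ℕ → ℝ) (g : ℝ → ℂ),
          (∀ t : ℝ, g t = ∑ j ∈ Finset.range k,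
              v j * Complex.exp (2 * (Real.pi : ℂ) * Complex.I * (f j : ℂ) * (t : ℂ))) →
          ∀ x ∈ Set.Icc (-1 : ℝ) 1,
            ‖g x‖ ^ 2 ≤ A * (k : ℝ) ^ 3 * (Real.log k) ^ 2 *
              ((1 / 2) * ∫ y in (-1 : ℝ)..1, ‖g y‖ ^ 2) := by
  refine ⟨64, by norm_num, fun k hk v f g hg x hx => ?_⟩
  have hgc : Continuous g := by
    rw [funext hg]
    fun_prop
  obtain ⟨z, hz, hzmax⟩ := isCompact_Icc.exists_isMaxOn ⟨x, hx⟩ hgc.norm.continuousOn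
  have hsub : ∀ a b : ℝ, a ≤ b → -1 ≤ a → b ≤ 1 →
      ∫ y in a..b, ‖g y‖ ^ 2 ≤ ∫ y in (-1 : ℝ)..1, ‖g y‖ ^ 2 := fun a b hab ha hb =>
    intervalIntegral.integral_mono_interval ha hab hb (ae_of_all _ fun _ => sq_nonneg _)
      ((hgc.norm.pow 2).intervalIntegrable _ _)
  have hdir : ∀ σ : ℝ, (∀ t ∈ Set.Icc (0 : ℝ) 1, z + σ * t ∈ Set.Icc (-1 : ℝ) 1) →
      ‖g z‖ ^ 2 ≤ 8 * (k : ℝ) ^ 3 * ∫ t in (0 : ℝ)..1, ‖g (z + σ * t)‖ ^ 2 := fun σ hσ => by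
    set a : ℕ → ℂ := fun j => 2 * (Real.pi : ℂ) * Complex.I * (f j : ℂ)
    have hG : ∀ t : ℝ, exponentialSum (Finset.range k) (fun j => v j * Complex.exp (a j * z))
        (fun j => σ * a j) t = g (z + σ * t) := fun t => by
      rw [hg, exponentialSum]
      refine Finset.sum_congr rfl fun j _ => ?_
      rw [mul_assoc, ← Complex.exp_add]
      simp only [a]
      push_cast
      ring_nf
    have := norm_sq_exponentialSum_zero_le_of_isMax (S := Finset.range k)
      (fun j => v j * Complex.exp (a j * z)) (w := fun j => σ * a j)
      (fun j _ => by simp [a]) fun t ht => by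
        simp only [hG, mul_zero, add_zero]
        exact hzmax (hσ t ht)
    simpa only [hG, mul_zero, add_zero, Finset.card_range] using this
  have hbound : ‖g z‖ ^ 2 ≤ 8 * (k : ℝ) ^ 3 * ∫ y in (-1 : ℝ)..1, ‖g y‖ ^ 2 := by
    rcases le_total z 0 with h0 | h0
    · refine (hdir 1 fun t ht => ⟨by linarith [hz.1, ht.1], by linarith [ht.2]⟩).trans ?_
      gcongr
      simp only [one_mul]
      rw [intervalIntegral.integral_comp_add_left (fun y => ‖g y‖ ^ 2) z]
      exact hsub _ _ (by linarith) (by linarith [hz.1]) (by linarith)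
    · refine (hdir (-1) fun t ht => ⟨by linarith [ht.2], by linarith [hz.2, ht.1]⟩).trans ?_
      gcongr
      simp only [neg_mul, one_mul, ← sub_eq_add_neg]
      rw [intervalIntegral.integral_comp_sub_left (fun y => ‖g y‖ ^ 2) z]
      exact hsub _ _ (by linarith) (by linarith) (by linarith [hz.2])
  have hlog : 1 / 4 ≤ Real.log k ^ 2 := by
    have h1 : Real.log 2 ≤ Real.log k := Real.log_le_log two_pos (by exact_mod_cast hk)
    nlinarith [Real.log_two_gt_d9]
  have hI : 0 ≤ ∫ y in (-1 : ℝ)..1, ‖g y‖ ^ 2 :=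
    intervalIntegral.integral_nonneg (by norm_num) fun _ _ => sq_nonneg _
  calc ‖g x‖ ^ 2 ≤ ‖g z‖ ^ 2 := pow_le_pow_left₀ (norm_nonneg _) (hzmax hx) 2
    _ ≤ 8 * (k : ℝ) ^ 3 * ∫ y in (-1 : ℝ)..1, ‖g y‖ ^ 2 := hbound
    _ = 64 * (k : ℝ) ^ 3 * (1 / 4) * ((1 / 2) * ∫ y in (-1 : ℝ)..1, ‖g y‖ ^ 2) := by ring
    _ ≤ _ := by gcongr
end

section
/- There are absolute constants A and a such that for every integer k ≥ 2, every k-Fourier-sparse signal g, and every real t with |t| > 1, one has |g(t)|² ≤ A · k^A · ‖g‖₂² · |t|^{a·k²·log k}. (That is, there exists S = O(k² log k) such that |g(t)|² ≤ poly(k) · ‖g‖₂² · |t|^S outside the observation interval [−1,1].) -/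
open Real MeasureTheory

open Polynomial in
/-- A variant of Halász's polynomial: it equals `1` at `0`, vanishes at `1`, and is barely larger
than `1` on the unit circle. -/
lemma exists_polynomial_eval_one_eq_zero {ρ : ℝ} (h0 : 0 < ρ) (h1 : ρ < 1) {n : ℕ} (hn : 1 ≤ n) :
    ∃ P : ℂ[X], P.natDegree ≤ n ∧ P.eval 0 = 1 ∧ P.eval 1 = 0 ∧
      ∀ z : ℂ, ‖z‖ = 1 → ‖P.eval z‖ ≤ ρ⁻¹ * (1 + ρ ^ n) := by
  refine ⟨(1 - X) * ∑ i ∈ Finset.range n, (C (ρ : ℂ) * X) ^ i, ?_, ?_, by simp, ?_⟩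
  · have hsum : (∑ i ∈ Finset.range n, (C (ρ : ℂ) * X) ^ i).natDegree ≤ n - 1 := by
      refine natDegree_sum_le_of_forall_le _ _ fun i hi => ?_
      refine natDegree_pow_le.trans ?_
      have hX : (C (ρ : ℂ) * X).natDegree ≤ 1 :=
        (natDegree_C_mul_le _ _).trans natDegree_X_le
      have := Finset.mem_range.1 hi
      nlinarith [Nat.mul_le_mul_left i hX, Nat.le_sub_one_of_lt this]
    have hlin : (1 - X : ℂ[X]).natDegree ≤ 1 := by
      refine (natDegree_sub_le _ _).trans ?_
      simp
    refine natDegree_mul_le.trans ?_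
    omega
  · obtain ⟨m, rfl⟩ := Nat.exists_eq_add_of_le' hn
    simp [eval_finsetSum, Finset.sum_range_succ']
  · intro z hz
    have hle : ρ * ‖1 - z‖ ≤ ‖1 - ρ * z‖ := by
      have hsq : z.re * z.re + z.im * z.im = 1 := by
        rw [← Complex.normSq_apply, Complex.normSq_eq_norm_sq, hz]; norm_num
      have hre : z.re ≤ 1 := hz ▸ Complex.re_le_norm z
      refine le_of_sq_le_sq ?_ (norm_nonneg _)
      rw [mul_pow, ← Complex.normSq_eq_norm_sq, ← Complex.normSq_eq_norm_sq,
        Complex.normSq_apply, Complex.normSq_apply]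
      simp only [Complex.sub_re, Complex.one_re, Complex.sub_im, Complex.one_im, Complex.mul_re,
        Complex.ofReal_re, Complex.ofReal_im, Complex.mul_im]
      have hprod : 0 ≤ (1 - ρ) * (1 - ρ + 2 * ρ * (1 - z.re)) :=
        mul_nonneg (by linarith) (by nlinarith)
      nlinarith
    have hpos : 0 < ‖1 - (ρ : ℂ) * z‖ := by
      have := norm_sub_norm_le (1 : ℂ) (ρ * z)
      rw [norm_mul, hz, Complex.norm_real, Real.norm_of_nonneg h0.le, norm_one] at this
      linarith
    have hgeom : (1 - (ρ : ℂ) * z) * ∑ i ∈ Finset.range n, ((ρ : ℂ) * z) ^ i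
        = 1 - (ρ * z) ^ n := mul_neg_geom_sum _ _
    have hnum : ‖1 - ((ρ : ℂ) * z) ^ n‖ ≤ 1 + ρ ^ n := by
      refine (norm_sub_le _ _).trans ?_
      simp [hz, abs_of_pos h0]
    rw [← hgeom, norm_mul] at hnum
    simp only [eval_mul, eval_sub, eval_one, eval_X, eval_finsetSum, eval_pow, eval_C, norm_mul]
    set s := ‖∑ i ∈ Finset.range n, ((ρ : ℂ) * z) ^ i‖
    have hs : 0 ≤ s := norm_nonneg _
    rw [inv_mul_eq_div, le_div_iff₀ h0]
    nlinarith [mul_le_mul_of_nonneg_right hle hs]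

open Polynomial in
lemma sum_sq_norm_coeff_le_of_norm_eval_le {Q : ℂ[X]} {M : ℝ}
    (hM : ∀ z : ℂ, ‖z‖ = 1 → ‖Q.eval z‖ ≤ M) {n : ℕ} (hn : Q.natDegree < n) :
    ∑ i ∈ Finset.range n, ‖Q.coeff i‖ ^ 2 ≤ M ^ 2 := by
  have hsum : ∑ i ∈ Finset.range n, ‖Q.coeff i‖ ^ 2 = ∑ i ∈ Q.support, ‖Q.coeff i‖ ^ 2 := by
    refine (Finset.sum_subset (fun i hi => ?_) fun i _ hi => ?_).symm
    · exact Finset.mem_range.2 ((le_natDegree_of_mem_supp i hi).trans_lt hn)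
    · simp [notMem_support_iff.1 hi]
  rw [hsum, sum_sq_norm_coeff_eq_circleAverage]
  refine Real.circleAverage_mono_on_of_le_circle ?_ fun z hz => ?_
  · exact ContinuousOn.circleIntegrable' (by fun_prop)
  · have : ‖z‖ = 1 := by simpa using hz
    gcongr
    exact hM z this

open Polynomial in
/-- Any `k` points of the unit circle are zeros of a polynomial of degree at most `k ^ 2`
with constant coefficient `1` and whose coefficients have small `ℓ²` norm. -/
lemma exists_polynomial_vanishing_on_unit_points {k : ℕ} (hk : 2 ≤ k) (w : ℕ → ℂ)
    (hw : ∀ j, ‖w j‖ = 1) :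
    ∃ Q : ℂ[X], Q.natDegree ≤ k ^ 2 ∧ Q.coeff 0 = 1 ∧ (∀ j < k, Q.eval (w j) = 0) ∧
      ∑ i ∈ Finset.range (k ^ 2 + 1), ‖Q.coeff i‖ ^ 2 ≤ 9 * (k : ℝ) ^ 2 := by
  have hk0 : (0 : ℝ) < k := by positivity
  have hk1 : (1 : ℝ) < k := by exact_mod_cast hk
  set ρ : ℝ := ((k : ℝ)⁻¹) ^ ((k : ℝ)⁻¹) with hρ
  have hρ0 : 0 < ρ := by positivity
  have hρ1 : ρ < 1 := Real.rpow_lt_one (by positivity) (inv_lt_one_of_one_lt₀ hk1) (by positivity)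
  have hρk : ρ ^ k = (k : ℝ)⁻¹ := Real.rpow_inv_natCast_pow (by positivity) (by omega)
  obtain ⟨P, hdeg, hP0, hP1, hP⟩ :=
    exists_polynomial_eval_one_eq_zero hρ0 hρ1 (show 1 ≤ k by omega)
  set Q : ℂ[X] := ∏ j ∈ Finset.range k, P.comp (C (w j)⁻¹ * X) with hQ
  have heval (z : ℂ) : Q.eval z = ∏ j ∈ Finset.range k, P.eval ((w j)⁻¹ * z) := by
    simp [hQ, eval_prod, eval_comp]
  have hQdeg : Q.natDegree ≤ k ^ 2 := by
    refine (natDegree_prod_le _ _).trans ?_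
    refine (Finset.sum_le_card_nsmul _ _ k fun j _ => ?_).trans (by simp [sq])
    refine natDegree_comp_le.trans ?_
    have : (C (w j)⁻¹ * X).natDegree ≤ 1 := (natDegree_C_mul_le _ _).trans natDegree_X_le
    simpa using Nat.mul_le_mul hdeg this
  refine ⟨Q, hQdeg, ?_, fun j hj => ?_, ?_⟩
  · rw [coeff_zero_eq_eval_zero, heval]
    simp [hP0]
  · rw [heval]
    refine Finset.prod_eq_zero (Finset.mem_range.2 hj) ?_
    have : w j ≠ 0 := by
      intro h
      simpa [h] using hw j
    rw [inv_mul_cancel₀ this, hP1]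
  · have hbound (z : ℂ) (hz : ‖z‖ = 1) : ‖Q.eval z‖ ≤ 3 * k := by
      rw [heval, norm_prod]
      calc ∏ j ∈ Finset.range k, ‖P.eval ((w j)⁻¹ * z)‖
          ≤ ∏ _j ∈ Finset.range k, (ρ⁻¹ * (1 + ρ ^ k)) :=
            Finset.prod_le_prod (fun _ _ => norm_nonneg _) fun j _ => hP _ (by simp [hw, hz])
        _ = k * (1 + (k : ℝ)⁻¹) ^ k := by
            rw [Finset.prod_const, Finset.card_range, mul_pow, inv_pow, hρk, inv_inv]
        _ ≤ k * 3 := by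
            gcongr
            exact one_add_inv_pow_le_exp.trans Real.exp_one_lt_three.le
        _ = 3 * k := mul_comm _ _
    refine (sum_sq_norm_coeff_le_of_norm_eval_le hbound (Nat.lt_succ_of_le hQdeg)).trans_eq ?_
    ring

/-- A sum of `k` exponentials at a point is controlled by its values along any arithmetic
progression of length `k ^ 2` starting next to that point. -/
lemma norm_sq_exponential_sum_le {k : ℕ} (hk : 2 ≤ k) {v : ℕ → ℂ} {f : ℕ → ℝ} {g : ℝ → ℂ}
    (hg : ∀ x : ℝ, g x = ∑ j ∈ Finset.range k,
      v j * Complex.exp (2 * (Real.pi : ℂ) * Complex.I * (f j : ℂ) * (x : ℂ))) (t θ : ℝ) :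
    ‖g t‖ ^ 2 ≤ 9 * (k : ℝ) ^ 2 *
      ∑ i ∈ Finset.range (k ^ 2), ‖g (t - ((i : ℝ) + 1) * θ)‖ ^ 2 := by
  set w : ℕ → ℂ := fun j => Complex.exp ((-(2 * π * f j * θ) : ℝ) * Complex.I) with hw
  obtain ⟨Q, hdeg, h0, hroot, hsum⟩ := exists_polynomial_vanishing_on_unit_points hk w
    fun j => Complex.norm_exp_ofReal_mul_I _
  have hshift (i : ℕ) : g (t - (i : ℝ) * θ) = ∑ j ∈ Finset.range k,
      v j * Complex.exp (2 * (Real.pi : ℂ) * Complex.I * (f j : ℂ) * (t : ℂ)) * w j ^ i := by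
    rw [hg]
    refine Finset.sum_congr rfl fun j _ => ?_
    rw [hw, ← Complex.exp_nat_mul, mul_assoc (v j), ← Complex.exp_add]
    congr 2
    push_cast
    ring
  have hzero : ∑ i ∈ Finset.range (k ^ 2 + 1), Q.coeff i * g (t - (i : ℝ) * θ) = 0 := by
    simp_rw [hshift, Finset.mul_sum]
    rw [Finset.sum_comm]
    refine Finset.sum_eq_zero fun j hj => ?_
    have := hroot j (Finset.mem_range.1 hj)
    rw [Polynomial.eval_eq_sum_range' (Nat.lt_succ_of_le hdeg)] at this
    simp_rw [mul_left_comm (Q.coeff _)]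
    rw [← Finset.mul_sum, this, mul_zero]
  rw [Finset.sum_range_succ'] at hzero hsum
  have hgt : g t = -∑ i ∈ Finset.range (k ^ 2),
      Q.coeff (i + 1) * g (t - ((i : ℝ) + 1) * θ) := by
    refine eq_neg_of_add_eq_zero_right ?_
    simpa [h0] using hzero
  have hsum' : ∑ i ∈ Finset.range (k ^ 2), ‖Q.coeff (i + 1)‖ ^ 2 ≤ 9 * (k : ℝ) ^ 2 := by
    linarith [sq_nonneg ‖Q.coeff 0‖]
  calc ‖g t‖ ^ 2
      ≤ (∑ i ∈ Finset.range (k ^ 2),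
          ‖Q.coeff (i + 1)‖ * ‖g (t - ((i : ℝ) + 1) * θ)‖) ^ 2 := by
        rw [hgt, norm_neg]
        gcongr
        exact norm_sum_le_of_le _ fun i _ => (norm_mul _ _).le
    _ ≤ (∑ i ∈ Finset.range (k ^ 2), ‖Q.coeff (i + 1)‖ ^ 2) *
          ∑ i ∈ Finset.range (k ^ 2), ‖g (t - ((i : ℝ) + 1) * θ)‖ ^ 2 :=
        Finset.sum_mul_sq_le_sq_mul_sq _ _ _
    _ ≤ _ := by gcongr

lemma le_integral_of_le_sum_shifts_of_nonneg {h : ℝ → ℝ} (hc : Continuous h) (hpos : ∀ x, 0 ≤ h x)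
    {K : ℝ} (hK : 0 ≤ K) {m : ℕ} (hm : 0 < m)
    (hR : ∀ t θ, h t ≤ K * ∑ i ∈ Finset.range m, h (t - ((i : ℝ) + 1) * θ))
    {t : ℝ} (ht0 : 0 ≤ t) (ht1 : t ≤ 1) :
    h t ≤ K * (m : ℝ) ^ 2 * ∫ y in (-1 : ℝ)..1, h y := by
  have hm' : (0 : ℝ) < m := by exact_mod_cast hm
  set J := ∫ y in (-1 : ℝ)..1, h y with hJ
  have hterm (i : ℕ) (hi : i ∈ Finset.range m) :
      ∫ θ in (0 : ℝ)..(m : ℝ)⁻¹, h (t - ((i : ℝ) + 1) * θ) ≤ J := by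
    have hi1 : (i : ℝ) + 1 ≤ m := by exact_mod_cast Finset.mem_range.1 hi
    have hi0 : (0 : ℝ) < (i : ℝ) + 1 := by positivity
    have hle : ((i : ℝ) + 1) * (m : ℝ)⁻¹ ≤ 1 := by
      rw [← div_eq_mul_inv]; exact (div_le_one hm').2 hi1
    have hge : 0 ≤ ((i : ℝ) + 1) * (m : ℝ)⁻¹ := by positivity
    rw [intervalIntegral.integral_comp_sub_mul _ hi0.ne', smul_eq_mul, mul_zero, sub_zero]
    have hmono : ∫ y in (t - ((i : ℝ) + 1) * (m : ℝ)⁻¹)..t, h y ≤ J :=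
      intervalIntegral.integral_mono_interval (by linarith) (by linarith) ht1
        (Filter.Eventually.of_forall hpos) (hc.intervalIntegrable _ _)
    have hnn : 0 ≤ ∫ y in (t - ((i : ℝ) + 1) * (m : ℝ)⁻¹)..t, h y :=
      intervalIntegral.integral_nonneg (by linarith) fun x _ => hpos x
    refine le_trans (mul_le_of_le_one_left hnn ?_) hmono
    exact inv_le_one_of_one_le₀ (by linarith [(Nat.cast_nonneg i : (0 : ℝ) ≤ i)])
  have hint : ∫ _θ in (0 : ℝ)..(m : ℝ)⁻¹, h t ≤
      ∫ θ in (0 : ℝ)..(m : ℝ)⁻¹, K * ∑ i ∈ Finset.range m, h (t - ((i : ℝ) + 1) * θ) :=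
    intervalIntegral.integral_mono_on (by positivity) (by simp)
      (Continuous.intervalIntegrable (by fun_prop) _ _) fun θ _ => hR t θ
  rw [intervalIntegral.integral_const, intervalIntegral.integral_const_mul,
    intervalIntegral.integral_finsetSum
      fun i _ => Continuous.intervalIntegrable (by fun_prop) _ _, sub_zero, smul_eq_mul] at hint
  have hsum := Finset.sum_le_card_nsmul _ _ J hterm
  rw [Finset.card_range, nsmul_eq_mul] at hsum
  have hfin := hint.trans (mul_le_mul_of_nonneg_left hsum hK)
  rw [inv_mul_le_iff₀ hm'] at hfin
  linarith

lemma le_integral_of_le_sum_shifts {h : ℝ → ℝ} (hc : Continuous h) (hpos : ∀ x, 0 ≤ h x)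
    {K : ℝ} (hK : 0 ≤ K) {m : ℕ} (hm : 0 < m)
    (hR : ∀ t θ, h t ≤ K * ∑ i ∈ Finset.range m, h (t - ((i : ℝ) + 1) * θ))
    {t : ℝ} (ht : |t| ≤ 1) :
    h t ≤ K * (m : ℝ) ^ 2 * ∫ y in (-1 : ℝ)..1, h y := by
  rcases le_total 0 t with h0 | h0
  · exact le_integral_of_le_sum_shifts_of_nonneg hc hpos hK hm hR h0 (abs_le.1 ht).2
  · have := le_integral_of_le_sum_shifts_of_nonneg (h := fun x => h (-x)) (by fun_prop)
      (fun x => hpos _) hK hm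
      (fun t θ => by
        have := hR (-t) (-θ)
        simpa [sub_eq_add_neg, add_comm] using this)
      (t := -t) (by linarith) (by linarith [(abs_le.1 ht).1])
    simpa [intervalIntegral.integral_comp_neg] using this

lemma le_rpow_of_le_sum_shifts {h : ℝ → ℝ} {K B : ℝ} (hK : 0 ≤ K) (hB : 0 ≤ B) {m : ℕ}
    (hm : 2 ≤ m) (hD : 1 ≤ K * m)
    (hR : ∀ t θ, h t ≤ K * ∑ i ∈ Finset.range m, h (t - ((i : ℝ) + 1) * θ))
    (hle : ∀ t, |t| ≤ 1 → h t ≤ B) {t : ℝ} (ht : 1 < |t|) :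
    h t ≤ B * (K * m) * |t| ^ ((m : ℝ) * Real.log (K * m)) := by
  have hm2 : (2 : ℝ) ≤ m := by exact_mod_cast hm
  set D : ℝ := K * m with hDdef
  set S : ℝ := (m : ℝ) * Real.log D with hS
  set R : ℝ := ((m : ℝ) + 1) / (m - 1) with hRdef
  have hm1 : (0 : ℝ) < (m : ℝ) - 1 := by linarith
  have hR1 : 1 < R := by rw [hRdef, one_lt_div hm1]; linarith
  have hR0 : 0 < R := by linarith
  have hlogD : 0 ≤ Real.log D := Real.log_nonneg hD
  have hS0 : 0 ≤ S := by positivity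
  have hDR : D ≤ R ^ S := by
    rw [← Real.log_le_log_iff (by linarith) (by positivity), Real.log_rpow hR0, hS]
    have h1 : 1 - R⁻¹ ≤ Real.log R := Real.one_sub_inv_le_log_of_pos hR0
    have h2 : 1 ≤ (m : ℝ) * (1 - R⁻¹) := by
      rw [hRdef, inv_div, one_sub_div (by linarith), ← mul_div_assoc, le_div_iff₀ (by linarith)]
      linarith
    have h3 : 1 ≤ (m : ℝ) * Real.log R := h2.trans (by gcongr)
    nlinarith
  have hstep (x M : ℝ) (hM : ∀ u, |u| ≤ |x| / R → h u ≤ M) : h x ≤ D * M := by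
    refine (hR x (2 * x / (m + 1))).trans ?_
    rw [hDdef, mul_assoc]
    refine mul_le_mul_of_nonneg_left ?_ hK
    refine (Finset.sum_le_card_nsmul _ _ M fun i hi => hM _ ?_).trans_eq (by simp)
    have hi1 : (i : ℝ) + 1 ≤ m := by exact_mod_cast Finset.mem_range.1 hi
    have hi0 : (0 : ℝ) ≤ i := Nat.cast_nonneg i
    have hx : x - ((i : ℝ) + 1) * (2 * x / (m + 1)) = x * ((m - 1 - 2 * i) / (m + 1)) := by
      field_simp
      ring
    rw [hx, abs_mul, div_eq_mul_inv |x|, hRdef, inv_div, abs_div,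
      abs_of_pos (by linarith : (0 : ℝ) < m + 1)]
    gcongr
    rw [abs_le]
    constructor <;> linarith
  have main : ∀ r : ℕ, ∀ x : ℝ, 1 ≤ |x| → |x| ≤ R ^ r → h x ≤ B * D * |x| ^ S := by
    intro r
    have hbase (x : ℝ) (hx : 1 ≤ |x|) : B * D ≤ B * D * |x| ^ S :=
      le_mul_of_one_le_right (by positivity) (Real.one_le_rpow hx hS0)
    induction r with
    | zero =>
      intro x hx hxr
      rw [pow_zero] at hxr
      refine (hle x hxr).trans (le_trans ?_ (hbase x hx))
      exact le_mul_of_one_le_right hB hD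
    | succ r ih =>
      intro x hx hxr
      rcases le_total (|x| / R) 1 with hxR | hxR
      · refine (hstep x B fun u hu => hle u (hu.trans hxR)).trans ?_
        rw [mul_comm]
        exact hbase x hx
      · refine (hstep x (B * D * (|x| / R) ^ S) fun u hu => ?_).trans ?_
        · rcases le_total |u| 1 with hu1 | hu1
          · refine (hle u hu1).trans ((le_mul_of_one_le_right hB hD).trans ?_)
            exact le_mul_of_one_le_right (by positivity) (Real.one_le_rpow hxR hS0)
          · refine (ih u hu1 (hu.trans ?_)).trans (by gcongr)
            rw [div_le_iff₀ hR0, ← pow_succ]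
            exact hxr
        · rw [Real.div_rpow (abs_nonneg x) hR0.le]
          have hxS : 0 ≤ B * D * |x| ^ S := by positivity
          calc D * (B * D * (|x| ^ S / R ^ S)) = B * D * |x| ^ S * (D / R ^ S) := by ring
            _ ≤ B * D * |x| ^ S * 1 := by
              gcongr
              exact (div_le_one (by positivity)).2 hDR
            _ = _ := mul_one _
  obtain ⟨r, hr⟩ := pow_unbounded_of_one_lt |t| hR1
  exact main r t ht.le hr.le

/-- There exist absolute constants `A` and `a` such that for every `k ≥ 2`,
every `k`-Fourier-sparse signal `g`, and every `t` with `|t| > 1`,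
`|g t|² ≤ A · k^A · ‖g‖₂² · |t|^(a·k²·log k)`. -/
theorem sparse_growth_bound :
    ∃ A a : ℝ, 0 < A ∧ 0 < a ∧
      ∀ (k : ℕ), 2 ≤ k →
        ∀ (v : ℕ → ℂ) (f : ℕ → ℝ) (g : ℝ → ℂ),
          (∀ x : ℝ, g x = ∑ j ∈ Finset.range k,
              v j * Complex.exp (2 * (Real.pi : ℂ) * Complex.I * (f j : ℂ) * (x : ℂ))) →
          ∀ t : ℝ, 1 < |t| →
            ‖g t‖ ^ 2 ≤ A * (k : ℝ) ^ (A : ℝ) *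
              ((1 / 2) * ∫ y in (-1 : ℝ)..1, ‖g y‖ ^ 2) *
              |t| ^ (a * (k : ℝ) ^ 2 * Real.log k) := by
  refine ⟨162, 8, by norm_num, by norm_num, fun k hk v f g hg t ht => ?_⟩
  have hk2 : (2 : ℝ) ≤ k := by exact_mod_cast hk
  have hgc : Continuous g := by
    rw [funext hg]
    fun_prop
  have hR := norm_sq_exponential_sum_le hk hg
  have hJ : 0 ≤ ∫ y in (-1 : ℝ)..1, ‖g y‖ ^ 2 :=
    intervalIntegral.integral_nonneg (by norm_num) fun x _ => sq_nonneg _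
  have hk4 : (9 : ℝ) ≤ (k : ℝ) ^ 4 := by
    have : (2 : ℝ) ^ 4 ≤ (k : ℝ) ^ 4 := by gcongr
    linarith
  have hD : 1 ≤ 9 * (k : ℝ) ^ 2 * ((k ^ 2 : ℕ) : ℝ) := by
    push_cast
    nlinarith
  have hgrowth := le_rpow_of_le_sum_shifts (h := fun x => ‖g x‖ ^ 2) (by positivity)
    (by positivity) (show 2 ≤ k ^ 2 by nlinarith) hD hR
    (fun x hx => le_integral_of_le_sum_shifts (h := fun x => ‖g x‖ ^ 2) (by fun_prop)
      (fun x => sq_nonneg _) (by positivity) (by positivity) hR hx) ht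
  refine hgrowth.trans ?_
  have hexp : ((k ^ 2 : ℕ) : ℝ) * Real.log (9 * (k : ℝ) ^ 2 * ((k ^ 2 : ℕ) : ℝ)) ≤
      8 * (k : ℝ) ^ 2 * Real.log k := by
    have hlog : Real.log (9 * (k : ℝ) ^ 2 * ((k ^ 2 : ℕ) : ℝ)) ≤ 8 * Real.log k := by
      have : 8 * Real.log k = Real.log ((k : ℝ) ^ 8) := by simp
      rw [this]
      refine Real.log_le_log (by linarith) ?_
      push_cast
      nlinarith
    push_cast at hlog ⊢
    nlinarith [sq_nonneg (k : ℝ)]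
  have hpow : (k : ℝ) ^ 10 ≤ (k : ℝ) ^ (162 : ℝ) := by
    rw [← Real.rpow_natCast]
    exact Real.rpow_le_rpow_of_exponent_le (by linarith) (by norm_num)
  have hconst : 9 * (k : ℝ) ^ 2 * ((k ^ 2 : ℕ) : ℝ) ^ 2 * (∫ y in (-1 : ℝ)..1, ‖g y‖ ^ 2) *
      (9 * (k : ℝ) ^ 2 * ((k ^ 2 : ℕ) : ℝ)) ≤
      162 * (k : ℝ) ^ (162 : ℝ) * ((1 / 2) * ∫ y in (-1 : ℝ)..1, ‖g y‖ ^ 2) := by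
    calc _ = 162 * (k : ℝ) ^ 10 * ((1 / 2) * ∫ y in (-1 : ℝ)..1, ‖g y‖ ^ 2) := by
          push_cast
          ring
      _ ≤ _ := by gcongr
  exact mul_le_mul hconst (Real.rpow_le_rpow_of_exponent_le ht.le hexp) (by positivity)
    (by positivity)
end

section
/- There are absolute constants a ≥ 1 and A ≥ 1 such that for every integer k ≥ 2 and all complex numbers z₁, …, z_k with |z₁| = |z₂| = ⋯ = |z_k| = 1, there exist an integer d ≤ a·k²·log k and a polynomial P(z) = ∑_{j=0}^{d} c_j·z^j with complex coefficients satisfying: (1) P(z_i) = 0 for each i ∈ [k]; (2) c_0 = 1; (3) |c_j| ≤ A for every 0 ≤ j ≤ d; and (4) ∑_{j=1}^{d} |c_j|² ≤ A·k. -/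
open Real

open Matrix in
/-- The least-squares solution of `W c = -b` has norm at most `1` as soon as the rank-one update
by `b` at most doubles the Gram determinant of `W`. -/
lemma exists_mulVec_eq_neg_of_det_add_le {n m : Type*} [Fintype n] [DecidableEq n] [Fintype m]
    (W : Matrix n m ℂ) (b : n → ℂ) (h0 : (W * Wᴴ).det ≠ 0)
    (h2 : ‖(W * Wᴴ + vecMulVec b (star b)).det‖ ≤ 2 * ‖(W * Wᴴ).det‖) :
    ∃ c : m → ℂ, W *ᵥ c = -b ∧ ∑ j, ‖c j‖ ^ 2 ≤ 1 := by
  have hu : IsUnit (W * Wᴴ).det := isUnit_iff_ne_zero.mpr h0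
  set x : n → ℂ := (W * Wᴴ)⁻¹ *ᵥ b with hx
  have hWx : (W * Wᴴ) *ᵥ x = b := by
    rw [hx, mulVec_mulVec, mul_nonsing_inv _ hu, one_mulVec]
  have hdet : (W * Wᴴ + vecMulVec b (star b)).det = (W * Wᴴ).det * (1 + star b ⬝ᵥ x) := by
    rw [vecMulVec_eq Unit, det_add_replicateCol_mul_replicateRow hu,
      det_unique (n := Unit), Matrix.add_apply, one_apply_eq, Matrix.mul_assoc,
      ← replicateCol_mulVec, replicateRow_mul_replicateCol_apply]
  have hs : star b ⬝ᵥ x = ((∑ j, ‖(Wᴴ *ᵥ x) j‖ ^ 2 : ℝ) : ℂ) := by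
    calc star b ⬝ᵥ x = star (W *ᵥ (Wᴴ *ᵥ x)) ⬝ᵥ x := by rw [mulVec_mulVec, hWx]
      _ = star (Wᴴ *ᵥ x) ⬝ᵥ (Wᴴ *ᵥ x) := by
        rw [star_mulVec, ← dotProduct_mulVec]
      _ = _ := by
        simp [dotProduct, Complex.conj_mul']
  refine ⟨-(Wᴴ *ᵥ x), by rw [mulVec_neg, mulVec_mulVec, hWx], ?_⟩
  have hnn : 0 ≤ ∑ j, ‖(Wᴴ *ᵥ x) j‖ ^ 2 := by positivity
  rw [hdet, hs, norm_mul, mul_comm] at h2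
  have h3 := le_of_mul_le_mul_right h2 (norm_pos_iff.mpr h0)
  rw [← Complex.ofReal_one, ← Complex.ofReal_add, Complex.norm_real, Real.norm_eq_abs,
    abs_of_nonneg (by linarith)] at h3
  simpa using (by linarith : ∑ j, ‖(Wᴴ *ᵥ x) j‖ ^ 2 ≤ 1)

/-- `newtonCoeff z j i` is the coefficient of `∏ l < i, (X - z l)` in the Newton expansion
of `X ^ j`. -/
def newtonCoeff (z : ℕ → ℂ) : ℕ → ℕ → ℂ
  | 0, 0 => 1
  | 0, _ + 1 => 0
  | j + 1, 0 => z 0 * newtonCoeff z j 0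
  | j + 1, i + 1 => z (i + 1) * newtonCoeff z j (i + 1) + newtonCoeff z j i

lemma norm_newtonCoeff_le {z : ℕ → ℂ} (hz : ∀ i, ‖z i‖ ≤ 1) (j i : ℕ) :
    ‖newtonCoeff z j i‖ ≤ j.choose i := by
  induction j generalizing i with
  | zero => cases i <;> simp [newtonCoeff]
  | succ j ih =>
    have key : ∀ i, ‖z i * newtonCoeff z j i‖ ≤ j.choose i := fun i => by
      rw [norm_mul]
      exact (mul_le_of_le_one_left (norm_nonneg _) (hz i)).trans (ih i)
    cases i with
    | zero => simpa [newtonCoeff] using key 0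
    | succ i =>
      rw [newtonCoeff, Nat.choose_succ_succ', Nat.cast_add, add_comm (j.choose i : ℝ)]
      exact (norm_add_le _ _).trans (add_le_add (key _) (ih i))

lemma newtonCoeff_eq_zero_of_lt (z : ℕ → ℂ) {j i : ℕ} (h : j < i) : newtonCoeff z j i = 0 := by
  induction j generalizing i with
  | zero =>
    obtain ⟨i, rfl⟩ := Nat.exists_eq_succ_of_ne_zero h.ne'
    rfl
  | succ j ih =>
    obtain ⟨i, rfl⟩ := Nat.exists_eq_succ_of_ne_zero (Nat.ne_zero_of_lt h)
    rw [Nat.succ_eq_add_one, newtonCoeff, ih (by omega), ih (by omega), mul_zero, add_zero]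

lemma newtonCoeff_self (z : ℕ → ℂ) (j : ℕ) : newtonCoeff z j j = 1 := by
  induction j with
  | zero => rfl
  | succ j ih =>
    rw [newtonCoeff, ih, newtonCoeff_eq_zero_of_lt z (Nat.lt_succ_self j), mul_zero, zero_add]

lemma sum_newtonCoeff_succ (z : ℕ → ℂ) (w : ℂ) (j n : ℕ) :
    ∑ i ∈ Finset.range (n + 1), newtonCoeff z (j + 1) i * ∏ l ∈ Finset.range i, (w - z l) +
      newtonCoeff z j n * ∏ l ∈ Finset.range (n + 1), (w - z l) =
    w * ∑ i ∈ Finset.range (n + 1), newtonCoeff z j i * ∏ l ∈ Finset.range i, (w - z l) := by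
  induction n with
  | zero => simp [newtonCoeff]; ring
  | succ n ih =>
    rw [Finset.sum_range_succ, Finset.sum_range_succ _ (n + 1), mul_add, ← ih,
      Finset.prod_range_succ _ (n + 1), newtonCoeff]
    ring

lemma sum_newtonCoeff_mul_prod (z : ℕ → ℂ) {w : ℂ} {k l : ℕ} (hl : l < k) (hw : w = z l) (j : ℕ) :
    ∑ i ∈ Finset.range k, newtonCoeff z j i * ∏ l ∈ Finset.range i, (w - z l) = w ^ j := by
  obtain ⟨n, rfl⟩ := Nat.exists_eq_succ_of_ne_zero (Nat.ne_zero_of_lt hl)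
  induction j with
  | zero => simp [Finset.sum_range_succ', newtonCoeff]
  | succ j ih =>
    have h := sum_newtonCoeff_succ z w j n
    rw [Finset.prod_eq_zero (Finset.mem_range.mpr hl) (by rw [hw, sub_self]), mul_zero, add_zero,
      ih] at h
    rw [h, pow_succ']

/-- The `k × m` matrix whose columns are the Newton coordinates of `X ^ s, …, X ^ (s + m - 1)`. -/
def newtonMatrix (z : ℕ → ℂ) (k m s : ℕ) : Matrix (Fin k) (Fin m) ℂ :=
  Matrix.of fun i j => newtonCoeff z (j + s) i

/-- Multiplication by `X` modulo `∏ l < k, (X - z l)` in the Newton basis. -/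
def newtonShift (z : ℕ → ℂ) (k : ℕ) : Matrix (Fin k) (Fin k) ℂ :=
  Matrix.of fun i j => if j = i then z i else if (j : ℕ) + 1 = i then 1 else 0

lemma det_newtonShift (z : ℕ → ℂ) (k : ℕ) : (newtonShift z k).det = ∏ i : Fin k, z i := by
  rw [Matrix.det_of_isLowerTriangular]
  · simp [newtonShift]
  · intro i j hij
    have hij' : i < j := hij
    have h : (i : ℕ) < j := hij'
    simp only [newtonShift, Matrix.of_apply]
    rw [if_neg hij'.ne', if_neg (by omega)]

lemma newtonShift_mul_newtonMatrix (z : ℕ → ℂ) (k m s : ℕ) :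
    newtonShift z k * newtonMatrix z k m s = newtonMatrix z k m (s + 1) := by
  ext ⟨i, hi⟩ j
  rw [Matrix.mul_apply]
  simp only [newtonShift, newtonMatrix, Matrix.of_apply, ← add_assoc]
  cases i with
  | zero =>
    rw [Finset.sum_eq_single ⟨0, hi⟩]
    · simp [newtonCoeff]
    · intro b _ hb
      simp [hb]
    · simp
  | succ i =>
    rw [Finset.sum_eq_add (⟨i + 1, hi⟩ : Fin k) ⟨i, by omega⟩]
    · simp [newtonCoeff]
    · simp
    · rintro b - ⟨hb, hb'⟩
      have : (b : ℕ) ≠ i := fun h => hb' (Fin.ext h)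
      simp [hb, this]
    · simp
    · simp

open Matrix in
lemma newtonMatrix_mul_conjTranspose_succ (z : ℕ → ℂ) (k m : ℕ) :
    newtonMatrix z k (m + 1) 0 * (newtonMatrix z k (m + 1) 0)ᴴ =
      newtonMatrix z k m 1 * (newtonMatrix z k m 1)ᴴ +
        vecMulVec (fun i : Fin k => newtonCoeff z 0 i)
          (star fun i : Fin k => newtonCoeff z 0 i) := by
  ext i i'
  simp [Matrix.mul_apply, Fin.sum_univ_succ, newtonMatrix, vecMulVec_apply, add_comm]

open Matrix in
lemma norm_det_newtonMatrix_one {z : ℕ → ℂ} (hz : ∀ i, ‖z i‖ = 1) (k m : ℕ) :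
    ‖(newtonMatrix z k m 1 * (newtonMatrix z k m 1)ᴴ).det‖ =
      ‖(newtonMatrix z k m 0 * (newtonMatrix z k m 0)ᴴ).det‖ := by
  rw [← newtonShift_mul_newtonMatrix, conjTranspose_mul, Matrix.mul_assoc, det_mul,
    ← Matrix.mul_assoc, det_mul, det_conjTranspose, det_newtonShift]
  simp [hz]

open Matrix in
lemma det_newtonMatrix_self (z : ℕ → ℂ) (k : ℕ) :
    (newtonMatrix z k k 0 * (newtonMatrix z k k 0)ᴴ).det = 1 := by
  have h : (newtonMatrix z k k 0).det = 1 := by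
    rw [Matrix.det_of_isUpperTriangular]
    · simp [newtonMatrix, newtonCoeff_self]
    · intro i j hij
      have hij' : j < i := hij
      exact newtonCoeff_eq_zero_of_lt z hij'
  rw [det_mul, det_conjTranspose, h]
  simp

open Matrix in
lemma norm_det_newtonMatrix_le {z : ℕ → ℂ} (hz : ∀ i, ‖z i‖ = 1) {k m : ℕ} (hk : 2 ≤ k)
    (hkm : k ≤ m) :
    ‖(newtonMatrix z k m 0 * (newtonMatrix z k m 0)ᴴ).det‖ ≤ (m : ℝ) ^ (4 * k ^ 2) := by
  have hm : (1 : ℝ) ≤ m := by exact_mod_cast (by omega : 1 ≤ m)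
  have hr : ∀ (i : Fin k) (j : Fin m), ‖newtonCoeff z j i‖ ≤ (m : ℝ) ^ k := fun i j => by
    refine (norm_newtonCoeff_le (fun i => (hz i).le) _ _).trans ?_
    have h1 : (j : ℕ).choose i ≤ m ^ k :=
      calc (j : ℕ).choose i ≤ m.choose i := Nat.choose_le_choose _ j.2.le
        _ ≤ m ^ (i : ℕ) := Nat.choose_le_pow _ _
        _ ≤ m ^ k := Nat.pow_le_pow_right (by omega) i.2.le
    exact_mod_cast h1
  have hentry : ∀ i i' : Fin k, NormedField.toAbsoluteValue ℂ
      ((newtonMatrix z k m 0 * (newtonMatrix z k m 0)ᴴ) i i') ≤ (m : ℝ) ^ (2 * k + 1) := by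
    intro i i'
    change ‖(newtonMatrix z k m 0 * (newtonMatrix z k m 0)ᴴ) i i'‖ ≤ _
    rw [Matrix.mul_apply]
    refine (norm_sum_le _ _).trans ?_
    calc _ ≤ ∑ _j : Fin m, (m : ℝ) ^ k * (m : ℝ) ^ k := by
          refine Finset.sum_le_sum fun j _ => ?_
          rw [conjTranspose_apply, norm_mul, norm_star]
          exact mul_le_mul (hr i j) (hr i' j) (norm_nonneg _) (by positivity)
      _ = (m : ℝ) ^ (2 * k + 1) := by
          simp; ring
  have hdet := det_le hentry
  rw [Fintype.card_fin, nsmul_eq_mul] at hdet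
  have hfac : (k.factorial : ℝ) ≤ (m : ℝ) ^ k := by
    exact_mod_cast (Nat.factorial_le_pow k).trans (Nat.pow_le_pow_left hkm k)
  calc _ ≤ (k.factorial : ℝ) * ((m : ℝ) ^ (2 * k + 1)) ^ k := hdet
    _ ≤ (m : ℝ) ^ k * ((m : ℝ) ^ (2 * k + 1)) ^ k := by gcongr
    _ = (m : ℝ) ^ (k + (2 * k + 1) * k) := by rw [← pow_mul, ← pow_add]
    _ ≤ (m : ℝ) ^ (4 * k ^ 2) := pow_le_pow_right₀ hm (by nlinarith)

/-- The window length `128 k² log₂ k` beats the polynomial growth of the Gram determinants. -/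
lemma pow_lt_two_pow_window {k : ℕ} (hk : 2 ≤ k) :
    (128 * k ^ 2 * Nat.log 2 k) ^ (4 * k ^ 2) < 2 ^ (128 * k ^ 2 * Nat.log 2 k - k) := by
  set L := Nat.log 2 k with hL
  have hL1 : 1 ≤ L := Nat.log_pos (by norm_num) hk
  have hkL : k ≤ 2 ^ (2 * L) :=
    (Nat.lt_pow_succ_log_self (by norm_num) k).le.trans
      (Nat.pow_le_pow_right (by norm_num) (by omega))
  have hM : 128 * k ^ 2 * L ≤ 2 ^ (12 * L) :=
    calc 128 * k ^ 2 * L ≤ 2 ^ 7 * (2 ^ (2 * L)) ^ 2 * 2 ^ L := by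
          gcongr
          · norm_num
          · exact Nat.lt_two_pow_self.le
      _ = 2 ^ (7 + 5 * L) := by rw [← pow_mul, ← pow_add, ← pow_add]; congr 1; ring
      _ ≤ 2 ^ (12 * L) := Nat.pow_le_pow_right (by norm_num) (by omega)
  calc _ ≤ (2 ^ (12 * L)) ^ (4 * k ^ 2) := Nat.pow_le_pow_left hM _
    _ = 2 ^ (48 * (k ^ 2 * L)) := by rw [← pow_mul]; congr 1; ring
    _ < _ := by
      apply Nat.pow_lt_pow_right (by norm_num)
      have h1 : k ≤ k ^ 2 * L := by nlinarith [Nat.mul_le_mul (Nat.le_self_pow two_ne_zero k) hL1]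
      have h2 : 128 * k ^ 2 * L = 128 * (k ^ 2 * L) := by ring
      omega

open Matrix in
lemma exists_norm_det_newtonMatrix_succ_le {z : ℕ → ℂ} (hz : ∀ i, ‖z i‖ = 1) {k : ℕ}
    (hk : 2 ≤ k) :
    ∃ m < 128 * k ^ 2 * Nat.log 2 k,
      (newtonMatrix z k m 0 * (newtonMatrix z k m 0)ᴴ).det ≠ 0 ∧
      ‖(newtonMatrix z k (m + 1) 0 * (newtonMatrix z k (m + 1) 0)ᴴ).det‖ ≤
        2 * ‖(newtonMatrix z k m 0 * (newtonMatrix z k m 0)ᴴ).det‖ := by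
  set M := 128 * k ^ 2 * Nat.log 2 k with hM
  by_contra! hcon
  have hkM : k ≤ M := by
    have : 1 ≤ Nat.log 2 k := Nat.log_pos (by norm_num) hk
    nlinarith [Nat.mul_le_mul (Nat.le_self_pow two_ne_zero k) this]
  have hgrow : ∀ m, k ≤ m → m ≤ M →
      (2 : ℝ) ^ (m - k) ≤ ‖(newtonMatrix z k m 0 * (newtonMatrix z k m 0)ᴴ).det‖ := by
    intro m hm
    induction m, hm using Nat.le_induction with
    | base => intro _; rw [det_newtonMatrix_self]; simp
    | succ m hm ih =>
      intro hmM
      have h1 := ih (by omega)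
      have h2 := hcon m (by omega) (norm_pos_iff.mp (lt_of_lt_of_le (by positivity) h1))
      rw [Nat.succ_sub hm, pow_succ']
      linarith
  have h1 := (hgrow M hkM le_rfl).trans (norm_det_newtonMatrix_le hz hk hkM)
  have h2 : M ^ (4 * k ^ 2) < 2 ^ (M - k) := pow_lt_two_pow_window hk
  have h3 : ((M ^ (4 * k ^ 2) : ℕ) : ℝ) < ((2 ^ (M - k) : ℕ) : ℝ) := by exact_mod_cast h2
  push_cast at h3
  linarith

/-- There are absolute constants `a, A ≥ 1` such that for every `k ≥ 2` and
all unit complex numbers `z₁, …, z_k`, there exist `d ≤ a·k²·log k` and a polynomial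
`P(z) = ∑_{j=0}^{d} c_j z^j` with `P(z_i) = 0` for all `i`, `c 0 = 1`, `|c j| ≤ A` for
all `0 ≤ j ≤ d`, and `∑_{j=1}^{d} |c j|² ≤ A·k`. -/
theorem vanishing_polynomial_small_coeffs :
    ∃ a A : ℝ, 1 ≤ a ∧ 1 ≤ A ∧
      ∀ (k : ℕ), 2 ≤ k →
        ∀ z : Fin k → ℂ, (∀ i, ‖z i‖ = 1) →
          ∃ (d : ℕ) (c : ℕ → ℂ),
            (d : ℝ) ≤ a * (k : ℝ) ^ 2 * Real.log k ∧
            (∀ i : Fin k, ∑ j ∈ Finset.range (d + 1), c j * (z i) ^ j = 0) ∧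
            c 0 = 1 ∧
            (∀ j ≤ d, ‖c j‖ ≤ A) ∧
            (∑ j ∈ Finset.Icc 1 d, ‖c j‖ ^ 2) ≤ A * k := by
  refine ⟨256, 1, by norm_num, le_rfl, fun k hk z hz => ?_⟩
  set y : ℕ → ℂ := fun i => if h : i < k then z ⟨i, h⟩ else 1 with hy
  have hy1 : ∀ i, ‖y i‖ = 1 := fun i => by
    simp only [hy]
    split_ifs
    · exact hz _
    · simp
  obtain ⟨m, hmM, h0, h2⟩ := exists_norm_det_newtonMatrix_succ_le hy1 hk
  rw [newtonMatrix_mul_conjTranspose_succ, ← norm_det_newtonMatrix_one hy1] at h2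
  have h0' := norm_ne_zero_iff.mpr h0
  rw [← norm_det_newtonMatrix_one hy1] at h0'
  obtain ⟨c, hc, hc1⟩ := exists_mulVec_eq_neg_of_det_add_le _ _ (norm_ne_zero_iff.mp h0') h2
  set C : ℕ → ℂ := fun j => if j = 0 then 1 else if h : j - 1 < m then c ⟨j - 1, h⟩ else 0 with hC
  have hC0 : C 0 = 1 := by simp [hC]
  have hCs : ∀ j : Fin m, C (j + 1) = c j := fun j => by simp [hC]
  have hsum : ∑ j ∈ Finset.Icc 1 m, ‖C j‖ ^ 2 ≤ 1 := by
    have : ∑ j ∈ Finset.Icc 1 m, ‖C j‖ ^ 2 = ∑ j : Fin m, ‖c j‖ ^ 2 := by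
      rw [← Finset.Ico_add_one_right_eq_Icc, Finset.sum_Ico_eq_sum_range, Nat.add_sub_cancel,
        ← Fin.sum_univ_eq_sum_range (fun j => ‖C (1 + j)‖ ^ 2)]
      exact Finset.sum_congr rfl fun j _ => by rw [add_comm, hCs]
    rwa [this]
  refine ⟨m, C, ?_, fun l => ?_, hC0, fun j hj => ?_, ?_⟩
  · have hlog : (Nat.log 2 k : ℝ) * Real.log 2 ≤ Real.log k := by
      rw [← Real.log_pow]
      exact Real.log_le_log (by positivity)
        (by exact_mod_cast Nat.pow_log_le_self 2 (by omega : k ≠ 0))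
    have hlog2 : (1 / 2 : ℝ) < Real.log 2 := by linarith [Real.log_two_gt_d9]
    have h3 : (Nat.log 2 k : ℝ) ≤ 2 * Real.log k := by
      nlinarith [(Nat.cast_nonneg (Nat.log 2 k) : (0 : ℝ) ≤ _)]
    have h4 : (m : ℝ) ≤ 128 * (k : ℝ) ^ 2 * Nat.log 2 k := by exact_mod_cast hmM.le
    calc (m : ℝ) ≤ 128 * (k : ℝ) ^ 2 * Nat.log 2 k := h4
      _ ≤ 128 * (k : ℝ) ^ 2 * (2 * Real.log k) := by gcongr
      _ = 256 * (k : ℝ) ^ 2 * Real.log k := by ring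
  · have hzl : z l = y l := by simp [hy]
    have hpow := sum_newtonCoeff_mul_prod y l.2 hzl
    have hcoord : ∀ i : Fin k,
        ∑ j : Fin m, newtonCoeff y (j + 1) i * c j = -newtonCoeff y 0 i := fun i => by
      simpa [Matrix.mulVec, dotProduct, newtonMatrix] using congrFun hc i
    rw [Finset.sum_range_succ', hC0, pow_zero, mul_one,
      ← Fin.sum_univ_eq_sum_range (fun j => C (j + 1) * z l ^ (j + 1))]
    simp_rw [hCs, ← hpow, ← Fin.sum_univ_eq_sum_range
      (fun i => newtonCoeff y _ i * ∏ l' ∈ Finset.range i, (z l - y l')), Finset.mul_sum]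
    rw [Finset.sum_comm]
    have hinner : ∀ i : Fin k,
        ∑ j : Fin m, c j * (newtonCoeff y (j + 1) i * ∏ l' ∈ Finset.range i, (z l - y l')) =
          -(newtonCoeff y 0 i * ∏ l' ∈ Finset.range i, (z l - y l')) := fun i => by
      rw [← neg_mul, ← hcoord, Finset.sum_mul]
      exact Finset.sum_congr rfl fun j _ => by ring
    simp_rw [hinner]
    rw [Finset.sum_neg_distrib, Fin.sum_univ_eq_sum_range
      (fun i => newtonCoeff y 0 i * ∏ l' ∈ Finset.range i, (z l - y l')), hpow 0, pow_zero]
    ring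
  · rcases Nat.eq_zero_or_pos j with rfl | hj0
    · simp [hC0]
    · have h5 : ‖C j‖ ^ 2 ≤ 1 :=
        (Finset.single_le_sum (f := fun j => ‖C j‖ ^ 2) (fun _ _ => by positivity)
          (Finset.mem_Icc.mpr ⟨hj0, hj⟩)).trans hsum
      exact (sq_le_one_iff₀ (norm_nonneg _)).mp h5
  · rw [one_mul]
    exact hsum.trans (by exact_mod_cast (by omega : 1 ≤ k))
end

section
/- There exist absolute constants C₁ > 1 and A such that for every integer k ≥ 2, every k-Fourier-sparse signal g, and every x ≥ 1, one has |g(x)| ≤ A·k^A·‖g‖₂·C₁^{(x−1)·k²·log k}. -/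
open Real MeasureTheory

open Polynomial in
lemma exists_polynomial_eval_one_eq_zero_norm_le {k : ℕ} (hk : 2 ≤ k) :
    ∃ Q : ℂ[X], Q.natDegree ≤ 2 * k ∧ Q.eval 0 = 1 ∧ Q.eval 1 = 0 ∧
      ∀ z : ℂ, ‖z‖ = 1 → ‖Q.eval z‖ ≤ 1 + 2 / k := by
  have hk' : (2 : ℝ) ≤ k := by exact_mod_cast hk
  have hk0 : (0 : ℝ) < k := by linarith
  obtain ⟨r, hr⟩ : ∃ r : ℝ, r = 1 - 1 / k := ⟨_, rfl⟩
  have hr1 : (1 - r) * k = 1 := by rw [hr]; field_simp; ring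
  have hrhalf : 1 / 2 ≤ r := by nlinarith
  have hrlt : r < 1 := by nlinarith
  let V : ℕ → ℂ[X] := fun i => ∑ j ∈ Finset.range i, (C (r : ℂ) * X) ^ j
  have hV : ∀ i, V (i + 1) = 1 + C (r : ℂ) * X * V i := by
    intro i
    simp only [V]
    rw [Finset.sum_range_succ', Finset.mul_sum, add_comm]
    simp [pow_succ']
  let Y : ℕ → ℂ[X] := fun i => X * V i - C (r : ℂ) * V (i + 1)
  let B : ℂ[X] := C (1 / (2 * k : ℂ)) * ∑ i ∈ Finset.range (2 * k), Y i
  have hVdeg : ∀ i, (V (i + 1)).natDegree ≤ i := by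
    intro i
    refine natDegree_sum_le_of_forall_le _ _ fun j hj => ?_
    have : j ≤ i := by simpa [Nat.lt_succ_iff] using hj
    refine natDegree_pow_le.trans ?_
    have : (C (r : ℂ) * X).natDegree ≤ 1 := (natDegree_C_mul_le _ _).trans natDegree_X_le
    nlinarith
  have hYdeg : ∀ i, (Y i).natDegree ≤ i := by
    intro i
    have h0 : (C (r : ℂ) * V (i + 1)).natDegree ≤ i := (natDegree_C_mul_le _ _).trans (hVdeg i)
    refine (natDegree_sub_le _ _).trans (max_le ?_ h0)
    cases i with
    | zero => simp [V]
    | succ n =>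
      refine natDegree_mul_le.trans ?_
      have := hVdeg n
      simp only [natDegree_X]
      omega
  have hBdeg : B.natDegree ≤ 2 * k := by
    refine (natDegree_C_mul_le _ _).trans (natDegree_sum_le_of_forall_le _ _ fun i hi => ?_)
    exact (hYdeg i).trans (Finset.mem_range.1 hi).le
  have hkC : (k : ℂ) ≠ 0 := by exact_mod_cast hk0.ne'
  have hV0 : ∀ i, (V (i + 1)).eval 0 = 1 := by
    intro i; rw [hV]; simp
  have hB0 : B.eval 0 = -r := by
    simp only [B, Y, eval_mul, eval_C, eval_finsetSum, eval_sub, eval_X, hV0]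
    simp
    field_simp
  have hYnorm : ∀ z : ℂ, ‖z‖ = 1 → ∀ i,
      ‖(Y i).eval z‖ ^ 2 = 1 + (1 - r ^ 2) * (‖(V i).eval z‖ ^ 2 - ‖(V (i + 1)).eval z‖ ^ 2) := by
    intro z hz i
    have h1 : ‖(V i).eval z‖ = ‖z * (V i).eval z‖ := by rw [norm_mul, hz, one_mul]
    have h2 : (V (i + 1)).eval z = 1 + r * (z * (V i).eval z) := by rw [hV]; simp; ring
    have h3 : (Y i).eval z = z * (V i).eval z - r * (V (i + 1)).eval z := by simp [Y]
    rw [h3, h1, h2]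
    generalize z * (V i).eval z = s
    simp only [Complex.sq_norm, Complex.normSq_apply]
    simp
    ring
  have hBnorm : ∀ z : ℂ, ‖z‖ = 1 → ‖B.eval z‖ ≤ 1 := by
    intro z hz
    have hsum : ∑ i ∈ Finset.range (2 * k), ‖(Y i).eval z‖ ^ 2 ≤ 2 * k := by
      rw [Finset.sum_congr rfl fun i _ => hYnorm z hz i, Finset.sum_add_distrib, ← Finset.mul_sum,
        Finset.sum_range_sub']
      have : (V 0).eval z = 0 := by simp [V]
      rw [this]
      have h : 0 ≤ (1 - r ^ 2) * ‖(V (2 * k)).eval z‖ ^ 2 := by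
        have : 0 ≤ 1 - r ^ 2 := by nlinarith
        positivity
      simp
      nlinarith
    have hcs := sq_sum_le_card_mul_sum_sq (s := Finset.range (2 * k))
      (f := fun i => ‖(Y i).eval z‖)
    have hle : ‖∑ i ∈ Finset.range (2 * k), (Y i).eval z‖ ≤ 2 * k := by
      refine (norm_sum_le _ _).trans (abs_le_of_sq_le_sq' ?_ (by positivity)).2
      refine hcs.trans ?_
      simp only [Finset.card_range]
      push_cast
      nlinarith
    simp only [B, eval_mul, eval_C, eval_finsetSum, norm_mul]
    have : ‖(1 / (2 * k : ℂ))‖ = 1 / (2 * k) := by simp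
    rw [this, one_div, inv_mul_le_iff₀ (by positivity)]
    simpa using hle
  obtain ⟨β, hβ, hβ0⟩ : ∃ β : ℝ, B.eval 1 = β ∧ 0 ≤ β := by
    refine ⟨1 / (2 * k) * ∑ i ∈ Finset.range (2 * k),
      (∑ j ∈ Finset.range i, r ^ j - r * ∑ j ∈ Finset.range (i + 1), r ^ j), ?_, ?_⟩
    · simp [B, Y, V, eval_finsetSum]
    · have h : ∀ i, ∑ j ∈ Finset.range i, r ^ j - r * ∑ j ∈ Finset.range (i + 1), r ^ j
          = 1 - (1 + r) * r ^ i := by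
        intro i
        have := geom_sum_mul_neg r i
        have h2 := geom_sum_mul_neg r (i + 1)
        have h3 : (1 - r) ≠ 0 := by linarith
        refine mul_right_cancel₀ h3 ?_
        rw [sub_mul, mul_assoc, this, h2]
        ring
      simp only [h]
      rw [Finset.sum_sub_distrib, ← Finset.mul_sum]
      have h4 := geom_sum_mul_neg r (2 * k)
      have h5 : ∑ j ∈ Finset.range (2 * k), r ^ j ≤ k := by
        have : 0 ≤ r ^ (2 * k) := by positivity
        nlinarith
      refine mul_nonneg (by positivity) ?_
      have h6 : 0 ≤ ∑ j ∈ Finset.range (2 * k), r ^ j :=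
        Finset.sum_nonneg fun _ _ => by positivity
      simp
      nlinarith
  have hden : (β + r : ℂ) ≠ 0 := by
    have : 0 < β + r := by linarith
    exact_mod_cast this.ne'
  refine ⟨C ((β + r : ℂ)⁻¹) * (C (β : ℂ) - B), ?_, ?_, ?_, ?_⟩
  · refine (natDegree_C_mul_le _ _).trans ((natDegree_sub_le _ _).trans ?_)
    simpa using hBdeg
  · simp [hB0, hden]
  · simp [hβ]
  · intro z hz
    have h1 : ‖(β : ℂ) - B.eval z‖ ≤ β + 1 := by
      refine (norm_sub_le _ _).trans (add_le_add ?_ (hBnorm z hz))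
      simp [abs_of_nonneg hβ0]
    have h2 : ‖((β + r : ℂ)⁻¹)‖ = (β + r)⁻¹ := by
      rw [norm_inv, ← Complex.ofReal_add, Complex.norm_real, Real.norm_of_nonneg (by linarith)]
    simp only [eval_mul, eval_C, eval_sub, norm_mul, h2]
    rw [inv_mul_le_iff₀ (by linarith)]
    refine h1.trans ?_
    have h3 : 1 / (k : ℝ) = 1 - r := by rw [hr]; ring
    have h4 : 2 / (k : ℝ) = 2 * (1 - r) := by rw [← h3]; ring
    rw [h4]
    nlinarith

open Polynomial in
lemma norm_coeff_le_of_norm_eval_le (p : ℂ[X]) {M : ℝ} (hM : 0 ≤ M)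
    (h : ∀ z : ℂ, ‖z‖ = 1 → ‖p.eval z‖ ≤ M) (j : ℕ) : ‖p.coeff j‖ ≤ M := by
  by_cases hj : j ∈ p.support
  · refine (abs_le_of_sq_le_sq' ?_ hM).2
    calc ‖p.coeff j‖ ^ 2 ≤ ∑ i ∈ p.support, ‖p.coeff i‖ ^ 2 :=
          Finset.single_le_sum (f := fun i => ‖p.coeff i‖ ^ 2) (fun _ _ => by positivity) hj
      _ = _ := p.sum_sq_norm_coeff_eq_circleAverage
      _ ≤ M ^ 2 := by
        refine circleAverage_mono_on_of_le_circle ?_ ?_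
        · apply ContinuousOn.circleIntegrable'
          fun_prop
        · intro z hz
          have : ‖z‖ = 1 := by simpa using hz
          have := h z this
          gcongr
  · rw [notMem_support_iff.1 hj]
    simpa using hM

open Polynomial in
lemma exists_annihilating_polynomial {k : ℕ} (hk : 2 ≤ k) (z : ℕ → ℂ) (hz : ∀ l, ‖z l‖ = 1) :
    ∃ R : ℂ[X], R.natDegree ≤ 2 * k ^ 2 ∧ R.coeff 0 = 1 ∧
      (∀ l ∈ Finset.range k, R.eval (z l) = 0) ∧ ∀ j, ‖R.coeff j‖ ≤ 8 := by
  obtain ⟨Q, hdeg, h0, h1, hQ⟩ := exists_polynomial_eval_one_eq_zero_norm_le hk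
  refine ⟨∏ l ∈ Finset.range k, Q.comp (C (z l)⁻¹ * X), ?_, ?_, ?_, ?_⟩
  · refine (natDegree_prod_le _ _).trans ?_
    refine (Finset.sum_le_card_nsmul _ _ (2 * k) fun l _ => ?_).trans ?_
    · refine natDegree_comp_le.trans ?_
      have := (natDegree_C_mul_le (z l)⁻¹ X).trans natDegree_X_le
      nlinarith
    · simp; nlinarith
  · simp [coeff_zero_eq_eval_zero, eval_prod, h0]
  · intro l hl
    rw [eval_prod]
    refine Finset.prod_eq_zero hl ?_
    have : z l ≠ 0 := by rw [← norm_ne_zero_iff, hz]; norm_num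
    simp [this, h1]
  · refine norm_coeff_le_of_norm_eval_le _ (by norm_num) fun w hw => ?_
    rw [eval_prod, norm_prod]
    have hk0 : (0 : ℝ) < k := by exact_mod_cast (by omega : 0 < k)
    calc _ ≤ ∏ l ∈ Finset.range k, Real.exp (2 / k) := by
          refine Finset.prod_le_prod (fun _ _ => norm_nonneg _) fun l _ => ?_
          have h2 := hQ ((z l)⁻¹ * w) (by simp [hz, hw])
          have h3 := Real.add_one_le_exp (2 / (k : ℝ))
          simp only [eval_comp, eval_mul, eval_C, eval_X]
          linarith
      _ = Real.exp 1 ^ 2 := by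
          rw [Finset.prod_const, Finset.card_range, ← Real.exp_nat_mul, ← Real.exp_nat_mul]
          congr 1
          push_cast
          field_simp
      _ ≤ 8 := by
          have := Real.exp_one_lt_d9
          have := Real.exp_pos 1
          nlinarith

/-- The exponential sum with coefficients `v` and frequencies `f`, as in the definition of a
`k`-Fourier-sparse signal. -/
def IsFourierSparse (k : ℕ) (v : ℕ → ℂ) (f : ℕ → ℝ) (g : ℝ → ℂ) : Prop :=
  ∀ t : ℝ, g t = ∑ j ∈ Finset.range k,
    v j * Complex.exp (2 * (Real.pi : ℂ) * Complex.I * (f j : ℂ) * (t : ℂ))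

namespace IsFourierSparse

variable {k : ℕ} {v : ℕ → ℂ} {f : ℕ → ℝ} {g : ℝ → ℂ}

lemma continuous (hg : IsFourierSparse k v f g) : Continuous g := by
  rw [funext hg]
  fun_prop

lemma norm_le_sum_shifts (hg : IsFourierSparse k v f g) (hk : 2 ≤ k) (x θ : ℝ) :
    ‖g x‖ ≤ 8 * ∑ j ∈ Finset.range (2 * k ^ 2), ‖g (x - (j + 1) * θ)‖ := by
  let e : ℕ → ℂ := fun l => Complex.exp (((-(2 * Real.pi * f l * θ) : ℝ) : ℂ) * Complex.I)
  obtain ⟨R, hdeg, h0, hR, hc⟩ :=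
    exists_annihilating_polynomial hk e fun l => Complex.norm_exp_ofReal_mul_I _
  have hshift : ∑ j ∈ Finset.range (2 * k ^ 2 + 1), R.coeff j * g (x - j * θ) = 0 := by
    have hterm : ∀ j : ℕ, R.coeff j * g (x - j * θ) = ∑ l ∈ Finset.range k,
        v l * Complex.exp (2 * (Real.pi : ℂ) * Complex.I * (f l : ℂ) * (x : ℂ)) *
          (R.coeff j * e l ^ j) := by
      intro j
      rw [hg, Finset.mul_sum]
      refine Finset.sum_congr rfl fun l _ => ?_
      have : Complex.exp (2 * (Real.pi : ℂ) * Complex.I * (f l : ℂ) * ((x - j * θ : ℝ) : ℂ)) =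
          Complex.exp (2 * (Real.pi : ℂ) * Complex.I * (f l : ℂ) * (x : ℂ)) * e l ^ j := by
        simp only [e]
        rw [← Complex.exp_nat_mul, ← Complex.exp_add]
        congr 1
        push_cast
        ring
      rw [this]
      ring
    simp only [hterm]
    rw [Finset.sum_comm]
    refine Finset.sum_eq_zero fun l hl => ?_
    rw [← Finset.mul_sum, ← Polynomial.eval_eq_sum_range' (by omega), hR l hl, mul_zero]
  rw [Finset.sum_range_succ', h0] at hshift
  have hx : g x = -∑ j ∈ Finset.range (2 * k ^ 2), R.coeff (j + 1) * g (x - (j + 1) * θ) := by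
    rw [eq_neg_iff_add_eq_zero, add_comm]
    simpa using hshift
  rw [hx, norm_neg, Finset.mul_sum]
  refine (norm_sum_le _ _).trans (Finset.sum_le_sum fun j _ => ?_)
  rw [norm_mul]
  gcongr
  exact hc _

lemma norm_sq_le_of_mem_Icc (hg : IsFourierSparse k v f g) (hk : 2 ≤ k) {x : ℝ} (hx0 : 0 ≤ x)
    (hx1 : x ≤ 1) :
    ‖g x‖ ^ 2 ≤ 64 * (2 * k ^ 2) ^ 3 * ∫ y in (-1 : ℝ)..1, ‖g y‖ ^ 2 := by
  have hcont := hg.continuous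
  obtain ⟨m, hm⟩ : ∃ m : ℕ, m = 2 * k ^ 2 := ⟨_, rfl⟩
  have hm0 : (0 : ℝ) < m := by
    have : 0 < m := by rw [hm]; positivity
    exact_mod_cast this
  have hpt : ∀ θ : ℝ, ‖g x‖ ^ 2 ≤
      64 * m * ∑ j ∈ Finset.range m, ‖g (x - (j + 1) * θ)‖ ^ 2 := by
    intro θ
    have h1 := hg.norm_le_sum_shifts hk x θ
    rw [← hm] at h1
    have h2 := sq_sum_le_card_mul_sum_sq (s := Finset.range m)
      (f := fun j => ‖g (x - (j + 1) * θ)‖)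
    rw [Finset.card_range] at h2
    have h3 := pow_le_pow_left₀ (norm_nonneg _) h1 2
    rw [mul_pow] at h3
    linarith
  have hshift : ∀ j ∈ Finset.range m, ∫ θ in (0 : ℝ)..1 / m, ‖g (x - (j + 1) * θ)‖ ^ 2 ≤
      ∫ y in (-1 : ℝ)..1, ‖g y‖ ^ 2 := by
    intro j hj
    have hj0 : (0 : ℝ) < j + 1 := by positivity
    have hjm : (j + 1 : ℝ) ≤ m := by exact_mod_cast Finset.mem_range.1 hj
    have hq : (j + 1) * (1 / m : ℝ) ≤ 1 := by
      rw [mul_one_div, div_le_one hm0]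
      exact hjm
    have hq0 : 0 ≤ (j + 1) * (1 / m : ℝ) := by positivity
    rw [intervalIntegral.integral_comp_sub_mul (fun y => ‖g y‖ ^ 2) hj0.ne', smul_eq_mul,
      mul_zero, sub_zero]
    have hmono : ∫ y in (x - (j + 1) * (1 / m : ℝ))..x, ‖g y‖ ^ 2 ≤
        ∫ y in (-1 : ℝ)..1, ‖g y‖ ^ 2 := by
      refine intervalIntegral.integral_mono_interval (by linarith) (by linarith) hx1
        (Filter.Eventually.of_forall fun y => by positivity) ?_
      exact (by fun_prop : Continuous fun y => ‖g y‖ ^ 2).intervalIntegrable _ _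
    have hnn : 0 ≤ ∫ y in (x - (j + 1) * (1 / m : ℝ))..x, ‖g y‖ ^ 2 :=
      intervalIntegral.integral_nonneg (by linarith) fun y _ => by positivity
    refine (mul_le_of_le_one_left hnn ?_).trans hmono
    refine inv_le_one_of_one_le₀ ?_
    have : (0 : ℝ) ≤ j := by positivity
    linarith
  have hint : ∫ _ in (0 : ℝ)..1 / m, ‖g x‖ ^ 2 ≤ ∫ θ in (0 : ℝ)..1 / m,
      64 * m * ∑ j ∈ Finset.range m, ‖g (x - (j + 1) * θ)‖ ^ 2 := by
    refine intervalIntegral.integral_mono (by positivity) ?_ ?_ hpt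
    · exact intervalIntegrable_const
    · exact Continuous.intervalIntegrable (by fun_prop) _ _
  rw [intervalIntegral.integral_const, intervalIntegral.integral_const_mul,
    intervalIntegral.integral_finsetSum
      fun j _ => Continuous.intervalIntegrable (by fun_prop) _ _, smul_eq_mul, sub_zero,
    one_div, inv_mul_le_iff₀ hm0] at hint
  have hsum := Finset.sum_le_card_nsmul _ _ _ hshift
  rw [Finset.card_range, nsmul_eq_mul, one_div] at hsum
  have hm' : (2 * k ^ 2 : ℝ) = m := by rw [hm]; push_cast; ring
  rw [hm']
  calc ‖g x‖ ^ 2 ≤ _ := hint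
    _ ≤ m * (64 * m * (m * ∫ y in (-1 : ℝ)..1, ‖g y‖ ^ 2)) := by gcongr
    _ = _ := by ring

lemma norm_le_mul_pow (hg : IsFourierSparse k v f g) (hk : 2 ≤ k) {B : ℝ}
    (hB : ∀ x ∈ Set.Icc (0 : ℝ) 1, ‖g x‖ ≤ B) (n : ℕ) :
    ∀ x ∈ Set.Icc (0 : ℝ) (1 + n / (2 * k ^ 2)), ‖g x‖ ≤ B * (16 * k ^ 2) ^ n := by
  have hk' : (2 : ℝ) ≤ k := by exact_mod_cast hk
  have hB0 : 0 ≤ B := (norm_nonneg _).trans (hB 0 (by simp))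
  induction n with
  | zero => simpa using hB
  | succ n ih =>
    rintro x ⟨hx0, hx1⟩
    rcases le_total x 1 with hx | hx
    · refine (hB x ⟨hx0, hx⟩).trans (le_mul_of_one_le_right hB0 (one_le_pow₀ ?_))
      nlinarith
    · have hm0 : (0 : ℝ) < 2 * k ^ 2 := by positivity
      have hterm : ∀ j ∈ Finset.range (2 * k ^ 2),
          ‖g (x - (j + 1) * (1 / (2 * k ^ 2 : ℝ)))‖ ≤ B * (16 * k ^ 2) ^ n := by
        intro j hj
        have hjm : (j + 1 : ℝ) ≤ 2 * k ^ 2 := by exact_mod_cast Finset.mem_range.1 hj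
        refine ih _ ⟨?_, ?_⟩
        · have : (j + 1) * (1 / (2 * k ^ 2) : ℝ) ≤ 1 := by
            rw [mul_one_div, div_le_one hm0]
            exact hjm
          linarith
        · have h1 : (1 + (n + 1 : ℕ) / (2 * k ^ 2) : ℝ) =
              1 + n / (2 * k ^ 2) + 1 / (2 * k ^ 2) := by push_cast; ring
          have h2 : 0 ≤ (j : ℝ) * (1 / (2 * k ^ 2)) := by positivity
          rw [h1] at hx1
          linarith
      have hsum := Finset.sum_le_card_nsmul _ _ _ hterm
      rw [Finset.card_range, nsmul_eq_mul] at hsum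
      push_cast at hsum
      calc ‖g x‖ ≤ _ := hg.norm_le_sum_shifts hk x (1 / (2 * k ^ 2 : ℝ))
        _ ≤ 8 * (2 * k ^ 2 * (B * (16 * k ^ 2) ^ n)) := by gcongr
        _ = _ := by ring

end IsFourierSparse

/-- There exist absolute constants `C₁ > 1` and `A` such that for every
`k ≥ 2`, every `k`-Fourier-sparse signal `g`, and every `x ≥ 1`,
`|g x| ≤ A · k^A · ‖g‖₂ · C₁^((x−1)·k²·log k)`. -/
theorem sparse_growth_near_one :
    ∃ C₁ A : ℝ, 1 < C₁ ∧ 0 < A ∧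
      ∀ (k : ℕ), 2 ≤ k →
        ∀ (v : ℕ → ℂ) (f : ℕ → ℝ) (g : ℝ → ℂ),
          (∀ t : ℝ, g t = ∑ j ∈ Finset.range k,
              v j * Complex.exp (2 * (Real.pi : ℂ) * Complex.I * (f j : ℂ) * (t : ℂ))) →
          ∀ x : ℝ, 1 ≤ x →
            ‖g x‖ ≤ A * (k : ℝ) ^ (A : ℝ) *
              Real.sqrt ((1 / 2) * ∫ y in (-1 : ℝ)..1, ‖g y‖ ^ 2) *
              C₁ ^ ((x - 1) * (k : ℝ) ^ 2 * Real.log k) := by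
  refine ⟨Real.exp 12, 512, by simp, by norm_num, ?_⟩
  intro k hk v f g hg x hx
  have hg : IsFourierSparse k v f g := hg
  have hk' : (2 : ℝ) ≤ k := by exact_mod_cast hk
  have hk0 : (0 : ℝ) < k := by linarith
  set I : ℝ := ∫ y in (-1 : ℝ)..1, ‖g y‖ ^ 2 with hI
  have hI0 : 0 ≤ I := intervalIntegral.integral_nonneg (by norm_num) fun y _ => by positivity
  set N : ℝ := Real.sqrt ((1 / 2) * I) with hN
  have hN2 : N ^ 2 = 1 / 2 * I := Real.sq_sqrt (by positivity)
  have hN0 : 0 ≤ N := Real.sqrt_nonneg _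
  have hB : ∀ y ∈ Set.Icc (0 : ℝ) 1, ‖g y‖ ≤ 32 * k ^ 3 * N := by
    rintro y ⟨hy0, hy1⟩
    refine (abs_le_of_sq_le_sq' ?_ (by positivity)).2
    refine (hg.norm_sq_le_of_mem_Icc hk hy0 hy1).trans (le_of_eq ?_)
    rw [mul_pow _ N, hN2]
    ring
  have hceil : 0 ≤ (x - 1) * (2 * k ^ 2) := mul_nonneg (by linarith) (by positivity)
  have hxn : x ≤ 1 + (⌈(x - 1) * (2 * k ^ 2)⌉₊ : ℝ) / (2 * k ^ 2) := by
    have := Nat.le_ceil ((x - 1) * (2 * k ^ 2 : ℝ))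
    rw [← le_div_iff₀ (by positivity)] at this
    linarith
  have hgx := hg.norm_le_mul_pow hk hB _ x ⟨by linarith, hxn⟩
  have hK1 : (1 : ℝ) ≤ 16 * k ^ 2 := by nlinarith
  have hK : (16 * k ^ 2 : ℝ) ≤ k ^ 6 := by
    have : (2 : ℝ) ^ 4 ≤ k ^ 4 := by gcongr
    calc (16 * k ^ 2 : ℝ) = 2 ^ 4 * k ^ 2 := by norm_num
      _ ≤ k ^ 4 * k ^ 2 := by gcongr
      _ = k ^ 6 := by ring
  have hpow : (16 * k ^ 2 : ℝ) ^ ⌈(x - 1) * (2 * k ^ 2 : ℝ)⌉₊ ≤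
      Real.exp 12 ^ ((x - 1) * (k : ℝ) ^ 2 * Real.log k) * (16 * k ^ 2) := by
    rw [← Real.rpow_natCast]
    calc (16 * k ^ 2 : ℝ) ^ (⌈(x - 1) * (2 * k ^ 2 : ℝ)⌉₊ : ℝ)
        ≤ (16 * k ^ 2 : ℝ) ^ ((x - 1) * (2 * k ^ 2 : ℝ) + 1) :=
          Real.rpow_le_rpow_of_exponent_le hK1 (Nat.ceil_lt_add_one hceil).le
      _ = (16 * k ^ 2 : ℝ) ^ ((x - 1) * (2 * k ^ 2 : ℝ)) * (16 * k ^ 2) := by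
          rw [Real.rpow_add (by positivity), Real.rpow_one]
      _ ≤ ((k : ℝ) ^ 6) ^ ((x - 1) * (2 * k ^ 2 : ℝ)) * (16 * k ^ 2) := by
          gcongr
      _ = _ := by
          rw [Real.rpow_def_of_pos (by positivity), Real.log_pow, ← Real.exp_mul]
          congr 2
          push_cast
          ring
  have hA : (k : ℝ) ^ 5 ≤ (k : ℝ) ^ (512 : ℝ) := by
    rw [← Real.rpow_natCast]
    exact Real.rpow_le_rpow_of_exponent_le (by linarith) (by norm_num)
  calc ‖g x‖ ≤ _ := hgx
    _ ≤ 32 * k ^ 3 * N *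
        (Real.exp 12 ^ ((x - 1) * (k : ℝ) ^ 2 * Real.log k) * (16 * k ^ 2)) := by gcongr
    _ = 512 * (k : ℝ) ^ 5 * N * Real.exp 12 ^ ((x - 1) * (k : ℝ) ^ 2 * Real.log k) := by ring
    _ ≤ _ := by gcongr
end

section
/- Let k ≥ 1 and let z₁, …, z_k ∈ ℂ satisfy |z_j| = 1 for all j, and let n ≥ k be an integer. Let r be the remainder of X^n upon division by the monic polynomial ∏_{j=1}^k (X − z_j) in ℂ[X], so r has degree at most k − 1. Then for every 0 ≤ i ≤ k − 1, the coefficient of X^i in r satisfies |r_i| ≤ binom(k−1, i) · binom(n, k−1). -/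
open Polynomial

theorem X_mul_modByMonic_mul_X_sub_C {R : Type*} [CommRing R] [Nontrivial R] {p : R[X]}
    (hp : p.Monic) (f : R[X]) (w : R) :
    (X * f) %ₘ (p * (X - C w)) = C w * (f %ₘ (p * (X - C w))) + (X - C w) * (f %ₘ p) := by
  have hq : (p * (X - C w)).Monic := hp.mul (monic_X_sub_C w)
  refine (div_modByMonic_unique (C w * (f /ₘ (p * (X - C w))) + f /ₘ p) _ hq ⟨?_, ?_⟩).2
  · linear_combination C w * modByMonic_add_div f (p * (X - C w)) +
      (X - C w) * modByMonic_add_div f p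
  · refine (degree_add_le _ _).trans_lt (max_lt ?_ ?_)
    · rw [← smul_eq_C_mul]
      exact (degree_smul_le _ _).trans_lt (degree_modByMonic_lt f hq)
    · rw [mul_comm, (monic_X_sub_C w).degree_mul, (monic_X_sub_C w).degree_mul, degree_X_sub_C]
      exact WithBot.add_lt_add_right (by simp) (degree_modByMonic_lt f hp)

theorem norm_coeff_X_pow_modByMonic_prod_le {m n : ℕ} (hn : m ≤ n) (z : Fin (m + 1) → ℂ)
    (hz : ∀ j, ‖z j‖ = 1) (i : ℕ) :
    ‖((X : ℂ[X]) ^ n %ₘ ∏ j, (X - C (z j))).coeff i‖ ≤ (m.choose i : ℝ) * n.choose m := by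
  induction m generalizing n i with
  | zero =>
    rw [Fin.prod_univ_one, modByMonic_X_sub_C_eq_C_eval, coeff_C]
    rcases i with _ | i <;> simp [hz]
  | succ m ih =>
    induction n, hn using Nat.le_induction generalizing i with
    | base =>
      have hP : (∏ j, (X - C (z j))).Monic := monic_prod_X_sub_C _ _
      rw [(modByMonic_eq_self_iff hP).2, coeff_X_pow]
      · split_ifs with h
        · simp [h]
        · simp
      · rw [degree_X_pow, degree_prod_of_monic _ _ fun j _ ↦ monic_X_sub_C (z j)]
        simp only [degree_X_sub_C, Finset.sum_const, Finset.card_univ, Fintype.card_fin,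
          nsmul_eq_mul, mul_one]
        exact_mod_cast Nat.lt_succ_self _
    | succ n hmn ihn =>
      have hP : (∏ j : Fin (m + 1), (X - C (z j.castSucc))).Monic := monic_prod_X_sub_C _ _
      have hr := ih (n := n) (by lia) (fun j ↦ z j.castSucc) fun j ↦ hz _
      have hs := ihn i
      rw [Fin.prod_univ_castSucc] at hs ⊢
      rw [pow_succ', X_mul_modByMonic_mul_X_sub_C hP, coeff_add, coeff_C_mul, sub_mul, coeff_sub,
        coeff_C_mul]
      refine (norm_add_le _ _).trans ((add_le_add le_rfl (norm_sub_le _ _)).trans ?_)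
      rw [norm_mul, norm_mul, hz, one_mul, one_mul, Nat.choose_succ_succ n m]
      have hri := hr i
      rcases i with _ | i
      · rw [coeff_X_mul_zero, norm_zero]
        simp only [Nat.choose_zero_right] at *
        push_cast at *
        linarith
      · rw [coeff_X_mul]
        have hri' := hr i
        rw [Nat.choose_succ_succ m i] at *
        push_cast at *
        linarith

/-- If `|z j| = 1` for all `j` and `n ≥ k`, then the remainder `r` of `X^n`
upon division by `∏_{j=1}^k (X − z_j)` has coefficients bounded by
`|r_i| ≤ C(k−1, i) · C(n, k−1)` for every `0 ≤ i ≤ k − 1`. -/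
theorem residual_coeff_bound (k n : ℕ) (hk : 1 ≤ k) (hn : k ≤ n)
    (z : Fin k → ℂ) (hz : ∀ j, ‖z j‖ = 1) :
    ∀ i ≤ k - 1,
      ‖((X : ℂ[X]) ^ n %ₘ ∏ j : Fin k, (X - C (z j))).coeff i‖ ≤
        ((k - 1).choose i : ℝ) * (n.choose (k - 1) : ℝ) := by
  intro i _
  obtain ⟨m, rfl⟩ := Nat.exists_eq_add_of_le' hk
  exact norm_coeff_X_pow_modByMonic_prod_le (by lia) z hz i
end

section
/- Let g(t) = ∑_{j=1}^k v_j·exp(2πi·f_j·t) be a k-Fourier-sparse signal, let θ ∈ ℝ and let n ≥ 0 be an integer. Set z_j = exp(2πi·f_j·θ) for j ∈ [k], and let r = ∑_{l=0}^{k−1} C_l·X^l be the remainder of X^n upon division by the monic polynomial ∏_{j=1}^k (X − z_j) in ℂ[X]. Then for every t ∈ ℝ, g(t) = ∑_{l=0}^{k−1} C_l · g(t − (n − l)·θ). -/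
open Polynomial Real

/-- Evaluating the remainder modulo a monic polynomial at a root of the divisor agrees with
evaluating the dividend; here the divisor is a nonempty product of linear factors and the value is
written as a sum of fixed length. -/
theorem sum_coeff_modByMonic_prod_X_sub_C {R : Type*} [CommRing R] [Nontrivial R] {k : ℕ}
    (p : R[X]) (z : Fin k → R) (j : Fin k) :
    ∑ l ∈ Finset.range k, (p %ₘ ∏ i : Fin k, (X - C (z i))).coeff l * z j ^ l =
      p.eval (z j) := by
  have hq : (∏ i : Fin k, (X - C (z i))).Monic := monic_prod_X_sub_C z Finset.univ
  have hdeg : (∏ i : Fin k, (X - C (z i))).natDegree = k := by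
    rw [natDegree_finsetProd_X_sub_C_eq_card]; simp
  have hroot : (∏ i : Fin k, (X - C (z i))).eval (z j) = 0 := by
    rw [eval_prod]
    exact Finset.prod_eq_zero (Finset.mem_univ j) (by simp)
  have hlt : (p %ₘ ∏ i : Fin k, (X - C (z i))).natDegree < k := by
    refine (natDegree_modByMonic_lt p hq fun h => ?_).trans_eq hdeg
    rw [h, natDegree_one] at hdeg
    exact j.pos.ne hdeg
  rw [← eval_eq_sum_range' hlt]
  conv_rhs => rw [← modByMonic_add_div p (∏ i : Fin k, (X - C (z i)))]
  simp [hroot]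

/-- Let `g` be a `k`-Fourier-sparse signal, `θ ∈ ℝ`, `n ≥ 0`. With
`z j = exp(2πi f_j θ)` and `r = ∑_{l=0}^{k−1} C_l X^l` the remainder of `X^n` mod
`∏_j (X − z_j)`, one has `g t = ∑_{l=0}^{k−1} C_l · g (t − (n − l)·θ)` for all `t`. -/
theorem sparse_residual_identity (k : ℕ) (hk : 1 ≤ k)
    (v : Fin k → ℂ) (f : Fin k → ℝ) (g : ℝ → ℂ)
    (hg : ∀ t : ℝ, g t = ∑ j : Fin k,
        v j * Complex.exp (2 * (Real.pi : ℂ) * Complex.I * (f j : ℂ) * (t : ℂ)))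
    (θ : ℝ) (n : ℕ)
    (z : Fin k → ℂ)
    (hz : ∀ j, z j = Complex.exp (2 * (Real.pi : ℂ) * Complex.I * (f j : ℂ) * (θ : ℂ)))
    (r : ℂ[X])
    (hr : r = (X : ℂ[X]) ^ n %ₘ ∏ j : Fin k, (X - C (z j))) :
    ∀ t : ℝ, g t = ∑ l ∈ Finset.range k,
      r.coeff l * g (t - ((n : ℝ) - (l : ℝ)) * θ) := by
  intro t
  have hshift (j : Fin k) (l : ℕ) :
      Complex.exp (2 * (Real.pi : ℂ) * Complex.I * (f j : ℂ) *
        ((t - ((n : ℝ) - (l : ℝ)) * θ : ℝ) : ℂ)) =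
      Complex.exp (2 * (Real.pi : ℂ) * Complex.I * (f j : ℂ) * ((t - n * θ : ℝ) : ℂ)) *
        z j ^ l := by
    rw [hz, ← Complex.exp_nat_mul, ← Complex.exp_add]
    congr 1
    push_cast
    ring
  have hfull (j : Fin k) :
      Complex.exp (2 * (Real.pi : ℂ) * Complex.I * (f j : ℂ) * (t : ℂ)) =
      Complex.exp (2 * (Real.pi : ℂ) * Complex.I * (f j : ℂ) * ((t - n * θ : ℝ) : ℂ)) *
        z j ^ n := by
    simpa using hshift j n
  simp only [hg, hshift, Finset.mul_sum]
  rw [Finset.sum_comm]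
  refine Finset.sum_congr rfl fun j _ => ?_
  have hsum := sum_coeff_modByMonic_prod_X_sub_C (X ^ n) z j
  rw [← hr, eval_pow, eval_X] at hsum
  rw [hfull, ← hsum, Finset.mul_sum, Finset.mul_sum]
  exact Finset.sum_congr rfl fun l _ => by ring
end

section
/- For every a ≥ 1 there exists a constant A = A(a) such that for all reals R, S ≥ 2 there exists a bounded continuous integrable function H : ℝ → ℝ with the following properties: (i) |H(x)| ≤ 1.01 for all x ∈ ℝ; (ii) there is L ≤ A·(R·log R + S·log S) such that the Fourier transform 𝓕H(f) = ∫_ℝ H(t)·exp(−2πi·f·t) dt vanishes for all |f| > L; (iii) for every continuous g : ℝ → ℂ satisfying sup_{t ∈ [−1,1]} |g(t)|² ≤ R·‖g‖₂² and |g(t)|² ≤ R^a·‖g‖₂²·|t|^S for all |t| > 1, one has ∫_{−1}^{1} |g(t)·H(t)|² dt ≥ 0.9·∫_{−1}^{1} |g(t)|² dt and ∫_{−1}^{1} |g(t)·H(t)|² dt ≥ 0.95·∫_{−∞}^{∞} |g(t)·H(t)|² dt. -/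
open Real MeasureTheory

open scoped FourierTransform Convolution

/-- `F` is the Fourier transform of an integrable function supported in `[-L, L]`. -/
def IsBandLimited (L : ℝ) (F : ℝ → ℂ) : Prop :=
  ∃ φ : ℝ → ℂ, Integrable φ ∧ (∀ x, L < |x| → φ x = 0) ∧ 𝓕 φ = F

namespace IsBandLimited

theorem mul {L₁ L₂ : ℝ} {F₁ F₂ : ℝ → ℂ} (h₁ : IsBandLimited L₁ F₁) (h₂ : IsBandLimited L₂ F₂) :
    IsBandLimited (L₁ + L₂) (fun t => F₁ t * F₂ t) := by
  obtain ⟨φ₁, hi₁, hs₁, rfl⟩ := h₁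
  obtain ⟨φ₂, hi₂, hs₂, rfl⟩ := h₂
  refine ⟨φ₁ ⋆[ContinuousLinearMap.mul ℂ ℂ] φ₂, hi₁.integrable_convolution _ hi₂, fun x hx => ?_,
    funext fun t => fourier_mul_convolution_eq hi₁ hi₂ t⟩
  rw [convolution_def]
  refine integral_eq_zero_of_ae (.of_forall fun y => ?_)
  by_cases hy : L₁ < |y|
  · simp [hs₁ y hy]
  · have : L₂ < |x - y| := by
      have := abs_sub_abs_le_abs_sub x y
      linarith
    simp [hs₂ _ this]

theorem sq {L : ℝ} {F : ℝ → ℂ} (h : IsBandLimited L F) :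
    IsBandLimited (2 * L) (fun t => F t ^ 2) := by
  simpa only [two_mul, pow_two] using h.mul h

theorem pow_succ {L : ℝ} {F : ℝ → ℂ} (h : IsBandLimited L F) (m : ℕ) :
    IsBandLimited ((m + 1) * L) (fun t => F t ^ (m + 1)) := by
  induction m with
  | zero => simpa using h
  | succ m ih =>
    have := ih.mul h
    convert this using 1
    · push_cast
      ring
    · exact funext fun t => _root_.pow_succ _ _

theorem mul_prod_range {L₀ : ℝ} {F₀ : ℝ → ℂ} (h₀ : IsBandLimited L₀ F₀) {L : ℕ → ℝ}
    {F : ℕ → ℝ → ℂ} (h : ∀ k, IsBandLimited (L k) (F k)) (n : ℕ) :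
    IsBandLimited (L₀ + ∑ k ∈ Finset.range n, L k)
      (fun t => F₀ t * ∏ k ∈ Finset.range n, F k t) := by
  induction n with
  | zero => simpa using h₀
  | succ n ih =>
    have := ih.mul (h n)
    simpa only [Finset.sum_range_succ, Finset.prod_range_succ, add_assoc, mul_assoc] using this

theorem sinc {B : ℝ} (hB : 0 < B) : IsBandLimited B (fun t => (Real.sinc (B * t) : ℂ)) := by
  have hpi := Real.pi_gt_three
  set c : ℝ := B / (2 * π) with hc
  have hc0 : 0 < c := by positivity
  have hcB : c ≤ B := div_le_self hB.le (by linarith)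
  refine ⟨(Set.Ioc (-c) c).indicator fun _ => ((π / B : ℝ) : ℂ), ?_, fun x hx => ?_, ?_⟩
  · exact (integrable_indicator_iff measurableSet_Ioc).2 (by simp)
  · refine Set.indicator_of_notMem (fun h => ?_) _
    have := abs_le.2 ⟨h.1.le, h.2⟩
    linarith
  · ext t
    rw [fourier_real_eq_integral_exp_smul]
    have h1 : (fun v : ℝ => Complex.exp (↑(-2 * π * v * t) * Complex.I) •
        (Set.Ioc (-c) c).indicator (fun _ => ((π / B : ℝ) : ℂ)) v) =
        (Set.Ioc (-c) c).indicator
          fun v => ((π / B : ℝ) : ℂ) * Complex.exp (↑(-2 * π * t * v) * Complex.I) := by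
      ext v
      by_cases hv : v ∈ Set.Ioc (-c) c
      · simp only [Set.indicator_of_mem hv, smul_eq_mul]
        rw [mul_comm, mul_right_comm (-2 * π)]
      · simp [Set.indicator_of_notMem hv]
    rw [h1, integral_indicator measurableSet_Ioc, ← intervalIntegral.integral_of_le (by linarith),
      intervalIntegral.integral_const_mul]
    rcases eq_or_ne t 0 with rfl | ht
    · simp only [mul_zero, zero_mul, Complex.ofReal_zero, Complex.exp_zero,
        intervalIntegral.integral_const, Real.sinc_zero]
      rw [hc, Complex.real_smul]
      push_cast
      have : (B : ℂ) ≠ 0 := by exact_mod_cast hB.ne'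
      have : (π : ℂ) ≠ 0 := by exact_mod_cast Real.pi_ne_zero
      field_simp
      norm_num
    · rw [intervalIntegral.integral_comp_mul_left
        (fun x : ℝ => Complex.exp (x * Complex.I)) (by simp [ht, Real.pi_ne_zero])]
      have h2 : -2 * π * t * c = -(B * t) := by rw [hc]; field_simp
      rw [mul_neg, h2, integral_exp_mul_I_eq_sinc, Real.sinc_neg, Complex.real_smul]
      push_cast
      have : (B : ℂ) ≠ 0 := by exact_mod_cast hB.ne'
      have : (π : ℂ) ≠ 0 := by exact_mod_cast Real.pi_ne_zero
      have : (t : ℂ) ≠ 0 := by exact_mod_cast ht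
      field_simp

theorem fourier_eq_zero {L : ℝ} {F : ℝ → ℂ} (h : IsBandLimited L F) (hF : Integrable F) {f : ℝ}
    (hf : L < |f|) : 𝓕 F f = 0 := by
  obtain ⟨φ, hi, hs, rfl⟩ := h
  have hev : φ =ᶠ[nhds (-f)] fun _ => 0 := by
    have : ∀ᶠ x : ℝ in nhds (-f), L < |x| :=
      continuous_abs.continuousAt.eventually_const_lt (by simpa using hf)
    filter_upwards [this] with x hx using hs x hx
  have := hi.fourierInv_fourier_eq hF (continuousAt_const.congr hev.symm)
  rw [fourierInv_eq_fourier_neg, neg_neg, hev.self_of_nhds] at this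
  exact this

end IsBandLimited

theorem sinc_sq_le_inv_sq {x : ℝ} (hx : x ≠ 0) : sinc x ^ 2 ≤ (x ^ 2)⁻¹ := by
  rw [sinc_of_ne_zero hx, div_pow, div_eq_mul_inv]
  exact mul_le_of_le_one_left (by positivity) (sin_sq_le_one x)

theorem sinc_sq_le_one (x : ℝ) : sinc x ^ 2 ≤ 1 :=
  (sq_le_one_iff_abs_le_one _).2 (abs_sinc_le_one x)

theorem one_sub_sq_le_sinc_sq {x : ℝ} (hx : |x| ≤ 1) : 1 - x ^ 2 ≤ sinc x ^ 2 := by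
  wlog h : 0 ≤ x generalizing x
  · simpa using this (x := -x) (by simpa using hx) (by linarith)
  rcases h.eq_or_lt with rfl | h
  · simp
  have hx1 : x ≤ 1 := (le_abs_self x).trans hx
  have h1 : 1 - x ^ 2 / 4 ≤ sinc x := by
    rw [sinc_of_ne_zero h.ne', le_div_iff₀ h]
    have := sin_gt_sub_cube h
    nlinarith [pow_pos h 3]
  nlinarith [pow_le_pow_left₀ (show 0 ≤ 1 - x ^ 2 / 4 by nlinarith) h1 2]

theorem prod_range_le_pow {f : ℕ → ℝ} {c : ℝ} {n : ℕ} (h₀ : ∀ k < n, 0 ≤ f k)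
    (h : ∀ k < n, f k ≤ c) : ∏ k ∈ Finset.range n, f k ≤ c ^ n := by
  calc _ ≤ ∏ _k ∈ Finset.range n, c :=
        Finset.prod_le_prod (fun k hk => h₀ k (Finset.mem_range.1 hk))
          fun k hk => h k (Finset.mem_range.1 hk)
    _ = _ := by simp

/-- A product of `sinc²` over the scales `1, …, n` decays like `exp (-x / 2)` as long as `x` is at
most of order `n`, and like `x ^ (-n)` beyond. -/
theorem prod_sinc_sq_le (n : ℕ) {x : ℝ} (hx : 0 ≤ x) :
    ∏ k ∈ Finset.range n, sinc (x / (k + 1)) ^ 2 ≤ 3 / (1 + x / (2 * n)) ^ n := by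
  rcases n.eq_zero_or_pos with rfl | hn
  · simp
  have hn' : (0 : ℝ) < n := by exact_mod_cast hn
  rw [le_div_iff₀ (by positivity)]
  rcases le_total (2 * n : ℝ) x with h | h
  · have hx0 : 0 < x := by linarith
    have h1 : ∏ k ∈ Finset.range n, sinc (x / (k + 1)) ^ 2 ≤ ((n / x) ^ 2) ^ n := by
      refine prod_range_le_pow (fun _ _ => sq_nonneg _) fun k hk => ?_
      refine (sinc_sq_le_inv_sq (by positivity)).trans ?_
      rw [← inv_pow, inv_div]
      have : (k : ℝ) + 1 ≤ n := by exact_mod_cast hk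
      gcongr
    calc _ ≤ ((n / x) ^ 2) ^ n * (1 + x / (2 * n)) ^ n := by gcongr
      _ = ((n / x) ^ 2 * (1 + x / (2 * n))) ^ n := (mul_pow _ _ _).symm
      _ ≤ 1 := by
        refine pow_le_one₀ (by positivity) ?_
        have : (n / x) ^ 2 * (1 + x / (2 * n)) = (n ^ 2 + n * x / 2) / x ^ 2 := by field_simp
        rw [this, div_le_one (by positivity)]
        nlinarith
      _ ≤ 3 := by norm_num
  · set j := ⌊x / 2⌋₊ with hj
    have hjn : j ≤ n := Nat.floor_le_of_le (by linarith)
    have hjx : (j : ℝ) ≤ x / 2 := Nat.floor_le (by linarith)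
    have hxj : x / 2 < j + 1 := Nat.lt_floor_add_one _
    have h1 : ∏ k ∈ Finset.range n, sinc (x / (k + 1)) ^ 2 ≤ exp (-1) ^ j := by
      calc _ ≤ ∏ k ∈ Finset.range j, sinc (x / (k + 1)) ^ 2 := by
            rw [← Finset.prod_range_mul_prod_Ico _ hjn]
            exact mul_le_of_le_one_right (Finset.prod_nonneg fun _ _ => sq_nonneg _)
              (Finset.prod_le_one (fun _ _ => sq_nonneg _) fun _ _ => sinc_sq_le_one _)
        _ ≤ _ := by
          refine prod_range_le_pow (fun _ _ => sq_nonneg _) fun k hk => ?_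
          have hk : (k : ℝ) + 1 ≤ j := by exact_mod_cast hk
          have hx0 : 0 < x := by have : (0 : ℝ) ≤ k := k.cast_nonneg; linarith
          refine (sinc_sq_le_inv_sq (by positivity)).trans ?_
          rw [exp_neg]
          have h2 : 2 ≤ x / (k + 1) := by rw [le_div_iff₀ (by positivity)]; linarith
          have := exp_one_lt_d9
          gcongr
          nlinarith
    have h2 : (1 + x / (2 * n)) ^ n ≤ exp (x / 2) := by
      calc _ ≤ exp (x / (2 * n)) ^ n := by
            gcongr
            linarith [add_one_le_exp (x / (2 * n))]
        _ = exp (x / 2) := by rw [← exp_nat_mul]; congr 1; field_simp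
    calc _ ≤ exp (-1) ^ j * exp (x / 2) := by gcongr
      _ = exp (x / 2 - j) := by rw [← exp_nat_mul, ← exp_add]; ring_nf
      _ ≤ exp 1 := exp_le_exp.2 (by linarith)
      _ ≤ 3 := by linarith [exp_one_lt_d9]

/-- The unnormalized kernel: a high power of `sinc (B u)` for decay just outside a neighbourhood
of width `1 / B`, and a product of `sinc²` over scales for the growth at infinity. -/
noncomputable def sincKernel (B : ℝ) (m n : ℕ) (u : ℝ) : ℝ :=
  (sinc (B * u) ^ 2) ^ (m + 1) * ∏ k ∈ Finset.range n, sinc (B / (k + 1) * u) ^ 2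

section sincKernel

variable (B : ℝ) (m n : ℕ)

theorem continuous_sincKernel : Continuous (sincKernel B m n) := by
  unfold sincKernel
  fun_prop

theorem sincKernel_nonneg (u : ℝ) : 0 ≤ sincKernel B m n u :=
  mul_nonneg (by positivity) (Finset.prod_nonneg fun _ _ => sq_nonneg _)

theorem sincKernel_le_sinc_sq (u : ℝ) : sincKernel B m n u ≤ sinc (B * u) ^ 2 := by
  have h1 : ∏ k ∈ Finset.range n, sinc (B / (k + 1) * u) ^ 2 ≤ 1 :=
    Finset.prod_le_one (fun _ _ => sq_nonneg _) fun _ _ => sinc_sq_le_one _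
  have h2 : (sinc (B * u) ^ 2) ^ (m + 1) ≤ sinc (B * u) ^ 2 :=
    pow_le_of_le_one (sq_nonneg _) (sinc_sq_le_one _) m.succ_ne_zero
  exact (mul_le_of_le_one_right (by positivity) h1).trans h2

variable {B}

theorem integrable_sincKernel (hB : 1 ≤ B) : Integrable (sincKernel B m n) := by
  refine (integrable_inv_one_add_sq.const_mul 2).mono'
    (continuous_sincKernel B m n).aestronglyMeasurable (.of_forall fun u => ?_)
  rw [norm_of_nonneg (sincKernel_nonneg B m n u)]
  refine (sincKernel_le_sinc_sq B m n u).trans ?_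
  rw [← div_eq_mul_inv, le_div_iff₀ (by positivity)]
  rcases eq_or_ne u 0 with rfl | hu
  · simp
  have h1 := sinc_sq_le_one (B * u)
  have h2 : sinc (B * u) ^ 2 * u ^ 2 ≤ 1 := by
    have h3 := sinc_sq_le_inv_sq (x := B * u) (by positivity)
    rw [← one_div, le_div_iff₀ (by positivity), mul_pow] at h3
    refine le_trans ?_ h3
    gcongr
    exact le_mul_of_one_le_left (sq_nonneg u) (one_le_pow₀ hB)
  linarith

theorem half_le_sincKernel (hB : 0 < B) {u : ℝ} (hu : |u| ≤ 1 / (2 * B * (n + m + 1))) :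
    1 / 2 ≤ sincKernel B m n u := by
  set N : ℝ := n + m + 1 with hN
  have hN1 : 1 ≤ N := by rw [hN]; linarith [n.cast_nonneg (α := ℝ), m.cast_nonneg (α := ℝ)]
  have hBu : |B * u| ≤ 1 / (2 * N) := by
    rw [abs_mul, abs_of_pos hB]
    calc _ ≤ B * (1 / (2 * B * N)) := by gcongr
      _ = _ := by field_simp
  have hN2 : 1 / (2 * N) ≤ 1 := by rw [div_le_one (by positivity)]; linarith
  have key : ∀ x : ℝ, |x| ≤ |B * u| → 1 - 1 / (2 * N) ≤ sinc x ^ 2 := fun x hx => by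
    refine le_trans ?_ (one_sub_sq_le_sinc_sq (hx.trans (hBu.trans hN2)))
    have h1 : |x| ≤ 1 / (2 * N) := hx.trans hBu
    have : x ^ 2 ≤ 1 / (2 * N) := by
      rw [← sq_abs]
      nlinarith [abs_nonneg x]
    linarith
  have h0 : 0 ≤ 1 - 1 / (2 * N) := by linarith
  calc (1 / 2 : ℝ) = 1 + ((m + 1 + n : ℕ) : ℝ) * (-(1 / (2 * N))) := by
        have : ((m + 1 + n : ℕ) : ℝ) = N := by push_cast; rw [hN]; ring
        rw [this]
        field_simp
        norm_num
    _ ≤ (1 + -(1 / (2 * N))) ^ (m + 1 + n) := one_add_mul_le_pow (by linarith) _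
    _ = (1 - 1 / (2 * N)) ^ (m + 1) * ∏ k ∈ Finset.range n, (1 - 1 / (2 * N)) := by
        rw [Finset.prod_const, Finset.card_range, ← pow_add, sub_eq_add_neg]
    _ ≤ sincKernel B m n u := by
        unfold sincKernel
        gcongr with k hk
        · exact key _ le_rfl
        · refine key _ ?_
          rw [abs_mul, abs_mul, abs_div]
          gcongr
          refine div_le_self (abs_nonneg _) ?_
          rw [abs_of_nonneg (by positivity)]
          linarith [k.cast_nonneg (α := ℝ)]

theorem le_integral_sincKernel (hB : 1 ≤ B) :
    1 / (2 * B * (n + m + 1)) ≤ ∫ u, sincKernel B m n u := by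
  set ε : ℝ := 1 / (2 * B * (n + m + 1)) with hε
  have hε0 : 0 ≤ ε := by positivity
  have hK := integrable_sincKernel m n hB
  calc ε = ∫ _ in Set.Icc (-ε) ε, (1 / 2 : ℝ) := by
        simp only [setIntegral_const, Real.volume_real_Icc, smul_eq_mul]
        rw [max_eq_left (by linarith)]
        ring
    _ ≤ ∫ u in Set.Icc (-ε) ε, sincKernel B m n u :=
        setIntegral_mono_on (by simp) hK.integrableOn measurableSet_Icc fun u hu =>
          half_le_sincKernel m n (by linarith) (abs_le.2 hu)
    _ ≤ _ := setIntegral_le_integral hK (.of_forall (sincKernel_nonneg B m n))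

theorem sincKernel_le_of_le_abs (hB : 1 ≤ B) (hn : 2 * n ≤ B) {δ s u : ℝ} (hδ : 0 < δ)
    (hBδ : 10 ≤ B * δ) (hBδ' : 1 + δ ^ 2 ≤ (B * δ) ^ 2) (hs : 0 ≤ s) (hu : s + δ ≤ |u|) :
    sincKernel B m n u ≤ 3 / 100 ^ m / (1 + s) ^ n * (1 + u ^ 2)⁻¹ := by
  have hu0 : 0 < |u| := by linarith
  have hu0' : u ≠ 0 := abs_pos.1 hu0
  have hδu : δ ^ 2 ≤ u ^ 2 := by rw [← sq_abs u]; gcongr; linarith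
  have hBu : (B * u) ^ 2 = B ^ 2 * u ^ 2 := by ring
  have h0 : sinc (B * u) ^ 2 ≤ ((B * u) ^ 2)⁻¹ := sinc_sq_le_inv_sq (by positivity)
  have h1 : sinc (B * u) ^ 2 ≤ 1 / 100 := by
    refine h0.trans ?_
    rw [← one_div]
    gcongr
    rw [hBu]
    nlinarith
  have h2 : sinc (B * u) ^ 2 ≤ (1 + u ^ 2)⁻¹ := by
    refine h0.trans ?_
    gcongr
    have : 1 ≤ δ ^ 2 * (B ^ 2 - 1) := by nlinarith
    have : δ ^ 2 * (B ^ 2 - 1) ≤ u ^ 2 * (B ^ 2 - 1) := by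
      gcongr
      nlinarith
    linarith
  have h3 : ∏ k ∈ Finset.range n, sinc (B / (k + 1) * u) ^ 2 ≤ 3 / (1 + s) ^ n := by
    have := prod_sinc_sq_le n (x := B * |u|) (by positivity)
    calc ∏ k ∈ Finset.range n, sinc (B / (k + 1) * u) ^ 2
        = ∏ k ∈ Finset.range n, sinc (B * |u| / (k + 1)) ^ 2 := by
          refine Finset.prod_congr rfl fun k _ => ?_
          rcases abs_choice u with h | h <;> rw [h]
          · ring_nf
          · rw [mul_neg, neg_div, sinc_neg]
            ring_nf
      _ ≤ 3 / (1 + B * |u| / (2 * n)) ^ n := this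
      _ ≤ 3 / (1 + s) ^ n := by
          rcases n.eq_zero_or_pos with rfl | hn0
          · simp
          have hn' : (0 : ℝ) < n := by exact_mod_cast hn0
          gcongr
          rw [le_div_iff₀ (by positivity)]
          nlinarith
  calc sincKernel B m n u
      = (sinc (B * u) ^ 2) ^ m * sinc (B * u) ^ 2 *
          ∏ k ∈ Finset.range n, sinc (B / (k + 1) * u) ^ 2 := by rw [sincKernel, pow_succ]
    _ ≤ (1 / 100) ^ m * (1 + u ^ 2)⁻¹ * (3 / (1 + s) ^ n) := by
        gcongr
    _ = _ := by rw [one_div, inv_pow]; ring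

theorem setIntegral_sincKernel_le (hB : 1 ≤ B) (hn : 2 * n ≤ B) {δ s : ℝ} (hδ : 0 < δ)
    (hBδ : 10 ≤ B * δ) (hBδ' : 1 + δ ^ 2 ≤ (B * δ) ^ 2) (hs : 0 ≤ s) :
    ∫ u in {u : ℝ | s + δ ≤ |u|}, sincKernel B m n u ≤ 10 / 100 ^ m / (1 + s) ^ n := by
  have hms : MeasurableSet {u : ℝ | s + δ ≤ |u|} := measurableSet_le measurable_const (by fun_prop)
  have hi : Integrable fun u : ℝ => 3 / 100 ^ m / (1 + s) ^ n * (1 + u ^ 2)⁻¹ :=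
    integrable_inv_one_add_sq.const_mul _
  calc _ ≤ ∫ u in {u : ℝ | s + δ ≤ |u|}, 3 / 100 ^ m / (1 + s) ^ n * (1 + u ^ 2)⁻¹ :=
        setIntegral_mono_on (integrable_sincKernel m n hB).integrableOn hi.integrableOn hms
          fun u hu => sincKernel_le_of_le_abs m n hB hn hδ hBδ hBδ' hs hu
    _ ≤ ∫ u : ℝ, 3 / 100 ^ m / (1 + s) ^ n * (1 + u ^ 2)⁻¹ :=
        setIntegral_le_integral hi (.of_forall fun u => by positivity)
    _ = 3 / 100 ^ m / (1 + s) ^ n * π := by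
        rw [integral_const_mul, integral_univ_inv_one_add_sq]
    _ = (3 * π) / 100 ^ m / (1 + s) ^ n := by ring
    _ ≤ _ := by
        gcongr
        linarith [pi_lt_d2]

end sincKernel
theorem isBandLimited_sincKernel {B : ℝ} (hB : 0 < B) (m n : ℕ) :
    IsBandLimited (2 * B * (m + 1 + ∑ k ∈ Finset.range n, ((k : ℝ) + 1)⁻¹))
      (fun u => (sincKernel B m n u : ℂ)) := by
  have h := ((IsBandLimited.sinc hB).sq.pow_succ m).mul_prod_range
    (fun k : ℕ => (IsBandLimited.sinc (B := B / (k + 1)) (by positivity)).sq) n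
  convert h using 1
  · rw [mul_add, Finset.mul_sum]
    congr 1
    · ring
    · exact Finset.sum_congr rfl fun k _ => by ring
  · ext u
    simp [sincKernel]

theorem pow_mul_le_hundred_pow (p : ℕ) {n : ℕ} (hn : 2 ≤ n) :
    2000000 * n ^ (p + 1) * (n + (Nat.log 2 n + 1) * (p + 13) + 1) ≤
      100 ^ ((Nat.log 2 n + 1) * (p + 13)) := by
  set l := Nat.log 2 n + 1 with hl
  set m := l * (p + 13) with hm
  have hnl : n ≤ 2 ^ l := (Nat.lt_pow_succ_log_self (by norm_num) n).le
  have hl2 : 2 ≤ l := by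
    have : 1 ≤ Nat.log 2 n := Nat.log_pos (by norm_num) hn
    omega
  have hmm : m + 2 ≤ 2 ^ (m + 1) := Nat.lt_two_pow_self (n := m + 1)
  calc 2000000 * n ^ (p + 1) * (n + m + 1)
      ≤ 2000000 * n ^ (p + 1) * (n * (m + 2)) := by gcongr; nlinarith
    _ = 2000000 * n ^ (p + 2) * (m + 2) := by ring
    _ ≤ 2000000 * (2 ^ l) ^ (p + 2) * 2 ^ (m + 1) := by gcongr
    _ = 4000000 * (2 ^ l) ^ (p + 2) * 2 ^ m := by ring
    _ ≤ (2 ^ l) ^ 11 * (2 ^ l) ^ (p + 2) * 2 ^ m := by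
        gcongr
        calc 4000000 ≤ (2 ^ 2) ^ 11 := by norm_num
          _ ≤ (2 ^ l) ^ 11 := by gcongr; norm_num
    _ = 4 ^ m := by
        rw [← pow_add, ← pow_mul, show l * (11 + (p + 2)) = m by rw [hm]; ring, ← mul_pow]
        norm_num
    _ ≤ 100 ^ m := by gcongr; norm_num

theorem exists_bandLimited_kernel (p : ℕ) {n : ℕ} (hn : 2 ≤ n) :
    ∃ K : ℝ → ℝ, Continuous K ∧ (∀ u, 0 ≤ K u) ∧ Integrable K ∧ ∫ u, K u = 1 ∧
      (∀ s : ℝ, 0 ≤ s → ∫ u in {u : ℝ | s + 1 / (100 * n) ≤ |u|}, K u ≤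
        1 / (100 * n ^ p) / (1 + s) ^ n) ∧
      ∀ f : ℝ, 2000 * (3 * p + 50) * (n * log n) < |f| → 𝓕 (fun u => (K u : ℂ)) f = 0 := by
  have hn' : (2 : ℝ) ≤ n := by exact_mod_cast hn
  set l := Nat.log 2 n + 1 with hl
  set m := l * (p + 13) with hm
  set B : ℝ := 1000 * n with hB
  have hB1 : 1 ≤ B := by rw [hB]; linarith
  have hB0 : 0 < B := by linarith
  set Z := ∫ u, sincKernel B m n u with hZ
  have hZle : 1 / (2 * B * (n + m + 1)) ≤ Z := le_integral_sincKernel m n hB1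
  have hZ0 : 0 < Z := lt_of_lt_of_le (by positivity) hZle
  have hKi := integrable_sincKernel m n hB1
  refine ⟨fun u => Z⁻¹ * sincKernel B m n u, (continuous_sincKernel B m n).const_mul _,
    fun u => mul_nonneg (by positivity) (sincKernel_nonneg B m n u), hKi.const_mul _, ?_, ?_, ?_⟩
  · rw [integral_const_mul, inv_mul_cancel₀ hZ0.ne']
  · intro s hs
    have hBδ : B * (1 / (100 * n)) = 10 := by rw [hB]; field_simp; norm_num
    have hδ1 : (1 / (100 * n) : ℝ) ≤ 1 := by rw [div_le_one (by positivity)]; linarith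
    have h := setIntegral_sincKernel_le m n hB1 (by rw [hB]; linarith)
      (δ := 1 / (100 * n)) (by positivity) hBδ.ge
      (by rw [hBδ]; nlinarith [show (0 : ℝ) ≤ 1 / (100 * n) by positivity]) hs
    have hnum : (10 : ℝ) / 100 ^ m ≤ Z * (1 / (100 * n ^ p)) := by
      calc (10 : ℝ) / 100 ^ m ≤ 1 / (2 * B * (n + m + 1)) * (1 / (100 * n ^ p)) := by
            rw [one_div_mul_one_div, div_le_div_iff₀ (by positivity) (by positivity), one_mul]
            have := pow_mul_le_hundred_pow p hn
            rw [← hl, ← hm] at this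
            have : (2000000 * n ^ (p + 1) * (n + m + 1) : ℝ) ≤ 100 ^ m := by exact_mod_cast this
            refine le_trans (le_of_eq ?_) this
            rw [hB]
            ring
        _ ≤ _ := by gcongr
    rw [integral_const_mul, inv_mul_le_iff₀ hZ0]
    calc _ ≤ 10 / 100 ^ m / (1 + s) ^ n := h
      _ ≤ Z * (1 / (100 * n ^ p)) / (1 + s) ^ n := by gcongr
      _ = _ := by ring
  · intro f hf
    have hlog : 0.69 ≤ log n := by
      have := log_le_log (by norm_num) hn'
      linarith [log_two_gt_d9]
    have hl3 : (l : ℝ) ≤ 3 * log n := by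
      have h1 : (Nat.log 2 n : ℝ) * log 2 ≤ log n := by
        rw [← log_pow]
        refine log_le_log (by positivity) ?_
        exact_mod_cast Nat.pow_log_le_self 2 (by omega)
      have h2 : (l : ℝ) = Nat.log 2 n + 1 := by rw [hl]; push_cast; rfl
      have h3 : (Nat.log 2 n : ℝ) * 0.69 ≤ Nat.log 2 n * log 2 := by
        gcongr
        linarith [log_two_gt_d9]
      linarith
    have hharm : ∑ k ∈ Finset.range n, ((k : ℝ) + 1)⁻¹ ≤ 1 + log n := by
      have := harmonic_le_one_add_log n
      rw [harmonic] at this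
      push_cast at this
      exact this
    have hL : 2 * B * (m + 1 + ∑ k ∈ Finset.range n, ((k : ℝ) + 1)⁻¹) ≤
        2000 * (3 * p + 50) * (n * log n) := by
      have h1 : (m : ℝ) = l * (p + 13) := by rw [hm]; push_cast; rfl
      have h2 : (m : ℝ) ≤ 3 * log n * (p + 13) := by rw [h1]; gcongr
      calc _ ≤ 2 * B * ((3 * p + 50) * log n) := by
            gcongr
            linarith
        _ = _ := by rw [hB]; ring
    have h0 := (isBandLimited_sincKernel hB0 m n).fourier_eq_zero hKi.ofReal
      (hL.trans_lt hf)
    have h1 : (fun u => ((Z⁻¹ * sincKernel B m n u : ℝ) : ℂ)) =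
        (Z⁻¹ : ℂ) • fun u => (sincKernel B m n u : ℂ) := by
      ext u
      simp
    rw [h1, fourier_real_eq]
    rw [fourier_real_eq] at h0
    simp_rw [Pi.smul_apply, smul_comm _ (Z⁻¹ : ℂ), integral_smul, h0, smul_zero]

/-- The convolution of `K` with the indicator function of `[-w, w]`. -/
noncomputable def boxAverage (K : ℝ → ℝ) (w t : ℝ) : ℝ := ∫ u in (t - w)..(t + w), K u

section boxAverage

variable {K : ℝ → ℝ} {w : ℝ}

theorem ofReal_boxAverage_eq_convolution (hw : 0 ≤ w) :
    (fun t => (boxAverage K w t : ℂ)) =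
      ((Set.Ioc (-w) w).indicator fun _ => (1 : ℂ)) ⋆[ContinuousLinearMap.mul ℂ ℂ]
        fun u => (K u : ℂ) := by
  ext t
  rw [convolution_def]
  have : (fun y => ContinuousLinearMap.mul ℂ ℂ ((Set.Ioc (-w) w).indicator (fun _ => (1 : ℂ)) y)
      (K (t - y) : ℂ)) = (Set.Ioc (-w) w).indicator fun y => (K (t - y) : ℂ) := by
    ext y
    by_cases hy : y ∈ Set.Ioc (-w) w
    · simp [Set.indicator_of_mem hy]
    · simp [Set.indicator_of_notMem hy]
  rw [this, integral_indicator measurableSet_Ioc, ← intervalIntegral.integral_of_le (by linarith),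
    intervalIntegral.integral_comp_sub_left (fun u => (K u : ℂ)), boxAverage,
    intervalIntegral.integral_ofReal, sub_neg_eq_add]

theorem integrable_indicator_Ioc_one :
    Integrable ((Set.Ioc (-w) w).indicator fun _ => (1 : ℂ)) :=
  (integrable_indicator_iff measurableSet_Ioc).2 (by simp)

theorem integrable_boxAverage (hK : Integrable K) (hw : 0 ≤ w) : Integrable (boxAverage K w) := by
  have h : Integrable fun t => (boxAverage K w t : ℂ) := by
    rw [ofReal_boxAverage_eq_convolution hw]
    exact integrable_indicator_Ioc_one.integrable_convolution _ hK.ofReal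
  simpa using h.re

theorem fourier_boxAverage_eq_zero (hK : Integrable K) (hw : 0 ≤ w) {f : ℝ}
    (hf : 𝓕 (fun u => (K u : ℂ)) f = 0) : 𝓕 (fun t => (boxAverage K w t : ℂ)) f = 0 := by
  have hKc : Integrable fun u => (K u : ℂ) := hK.ofReal
  rw [ofReal_boxAverage_eq_convolution hw]
  exact (fourier_mul_convolution_eq integrable_indicator_Ioc_one hKc f).trans
    (by rw [hf, mul_zero])

theorem continuous_boxAverage (hK : Continuous K) : Continuous (boxAverage K w) := by
  have h : ∀ t, boxAverage K w t = (∫ u in (0)..(t + w), K u) - ∫ u in (0)..(t - w), K u :=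
    fun t => (intervalIntegral.integral_interval_sub_left (hK.intervalIntegrable _ _)
      (hK.intervalIntegrable _ _)).symm
  have hc : Continuous fun t => ∫ u in (0)..t, K u :=
    intervalIntegral.continuous_primitive (fun _ _ => hK.intervalIntegrable _ _) 0
  rw [funext h]
  exact (hc.comp (continuous_id.add continuous_const)).sub
    (hc.comp (continuous_id.sub continuous_const))

theorem boxAverage_eq_setIntegral (hw : 0 ≤ w) (t : ℝ) :
    boxAverage K w t = ∫ u in Set.Ioc (t - w) (t + w), K u :=
  intervalIntegral.integral_of_le (by linarith)

theorem boxAverage_nonneg (h₀ : ∀ u, 0 ≤ K u) (hw : 0 ≤ w) (t : ℝ) : 0 ≤ boxAverage K w t :=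
  intervalIntegral.integral_nonneg (by linarith) fun u _ => h₀ u

theorem boxAverage_le_integral (hK : Integrable K) (h₀ : ∀ u, 0 ≤ K u) (hw : 0 ≤ w) (t : ℝ) :
    boxAverage K w t ≤ ∫ u, K u := by
  rw [boxAverage_eq_setIntegral hw]
  exact setIntegral_le_integral hK (.of_forall h₀)

theorem boxAverage_le_tail (hK : Integrable K) (h₀ : ∀ u, 0 ≤ K u) (hw : 0 ≤ w) {r t : ℝ}
    (ht : r + w ≤ |t|) : boxAverage K w t ≤ ∫ u in {u : ℝ | r ≤ |u|}, K u := by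
  rw [boxAverage_eq_setIntegral hw]
  refine setIntegral_mono_set hK.integrableOn (.of_forall h₀) (LE.le.eventuallyLE ?_)
  intro u hu
  have : |t - u| ≤ w := abs_le.2 ⟨by linarith [hu.2], by linarith [hu.1]⟩
  have := abs_sub_abs_le_abs_sub t u
  show r ≤ |u|
  linarith

theorem integral_sub_tail_le_boxAverage (hK : Integrable K) (h₀ : ∀ u, 0 ≤ K u) (hw : 0 ≤ w)
    {r t : ℝ} (ht : |t| ≤ w - r) :
    (∫ u, K u) - ∫ u in {u : ℝ | r ≤ |u|}, K u ≤ boxAverage K w t := by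
  rw [boxAverage_eq_setIntegral hw, ← integral_add_compl measurableSet_Ioc hK, add_sub_assoc]
  have : ∫ u in (Set.Ioc (t - w) (t + w))ᶜ, K u ≤ ∫ u in {u : ℝ | r ≤ |u|}, K u := by
    refine setIntegral_mono_set hK.integrableOn (.of_forall h₀) (LE.le.eventuallyLE ?_)
    intro u hu
    show r ≤ |u|
    by_contra! h
    have h1 := abs_le.1 ht
    have h2 := abs_lt.1 h
    exact hu ⟨by linarith, by linarith⟩
  linarith

end boxAverage

/-- The integral of a function dominated by `c * (1 + t²)⁻¹` outside `[-1, 1]` exceeds its integral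
over `[-1, 1]` by at most `c * π`. -/
theorem integral_le_intervalIntegral_add {F : ℝ → ℝ} (hF : Continuous F) (h₀ : ∀ t, 0 ≤ F t)
    {c : ℝ} (hc : 0 ≤ c) (h : ∀ t, 1 < |t| → F t ≤ c * (1 + t ^ 2)⁻¹) :
    ∫ t, F t ≤ (∫ t in (-1 : ℝ)..1, F t) + c * π := by
  have hi : Integrable fun t : ℝ => c * (1 + t ^ 2)⁻¹ := integrable_inv_one_add_sq.const_mul c
  have hout : ∀ t ∈ (Set.Icc (-1 : ℝ) 1)ᶜ, F t ≤ c * (1 + t ^ 2)⁻¹ := fun t ht =>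
    h t (not_le.1 fun h' => ht (abs_le.1 h'))
  have hm : MeasurableSet (Set.Icc (-1 : ℝ) 1)ᶜ := measurableSet_Icc.compl
  have hFc : IntegrableOn F (Set.Icc (-1 : ℝ) 1)ᶜ := by
    refine hi.integrableOn.mono' hF.aestronglyMeasurable ?_
    filter_upwards [ae_restrict_mem hm] with t ht
    rw [norm_of_nonneg (h₀ t)]
    exact hout t ht
  have hFi : Integrable F := by
    rw [← integrableOn_univ, ← Set.union_compl_self (Set.Icc (-1 : ℝ) 1)]
    exact (hF.continuousOn.integrableOn_Icc).union hFc
  rw [← integral_add_compl measurableSet_Icc hFi, integral_Icc_eq_integral_Ioc,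
    ← intervalIntegral.integral_of_le (show (-1 : ℝ) ≤ 1 by norm_num)]
  gcongr
  calc ∫ t in (Set.Icc (-1 : ℝ) 1)ᶜ, F t
      ≤ ∫ t in (Set.Icc (-1 : ℝ) 1)ᶜ, c * (1 + t ^ 2)⁻¹ :=
        setIntegral_mono_on hFc hi.integrableOn hm hout
    _ ≤ ∫ t : ℝ, c * (1 + t ^ 2)⁻¹ :=
        setIntegral_le_integral hi (.of_forall fun t => by positivity)
    _ = c * π := by rw [integral_const_mul, integral_univ_inv_one_add_sq]

theorem intervalIntegral_sub_le_of_le {F : ℝ → ℝ} (hF : Continuous F) {M r : ℝ} (hr₀ : 0 ≤ r)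
    (hr₁ : r ≤ 1) (hM : ∀ t ∈ Set.Icc (-1 : ℝ) 1, F t ≤ M) :
    (∫ t in (-1 : ℝ)..1, F t) - 2 * r * M ≤ ∫ t in (-(1 - r))..(1 - r), F t := by
  have hi : ∀ a b : ℝ, IntervalIntegrable F volume a b := fun a b => hF.intervalIntegrable a b
  have h1 : ∫ t in (-1 : ℝ)..(-(1 - r)), F t ≤ ∫ _ in (-1 : ℝ)..(-(1 - r)), M :=
    intervalIntegral.integral_mono_on (by linarith) (hi _ _) (by simp)
      fun t ht => hM t ⟨ht.1, by linarith [ht.2]⟩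
  have h2 : ∫ t in (1 - r)..1, F t ≤ ∫ _ in (1 - r)..1, M :=
    intervalIntegral.integral_mono_on (by linarith) (hi _ _) (by simp)
      fun t ht => hM t ⟨by linarith [ht.1], ht.2⟩
  rw [intervalIntegral.integral_const, smul_eq_mul] at h1 h2
  rw [← intervalIntegral.integral_add_adjacent_intervals (hi (-1) (-(1 - r))) (hi _ 1),
    ← intervalIntegral.integral_add_adjacent_intervals (hi (-(1 - r)) (1 - r)) (hi _ 1)]
  linarith

/-- A function that is close to `1` inside `[-1, 1]` and decays fast enough outside preserves the
mass of `‖g‖²` on `[-1, 1]` and removes it elsewhere, provided `g` satisfies growth bounds. -/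
theorem filter_bounds {n p : ℕ} (hn : 2 ≤ n) {H : ℝ → ℝ} (hH : Continuous H)
    (h₀ : ∀ t, 0 ≤ H t)
    (hin : ∀ t : ℝ, |t| ≤ 1 - 1 / (50 * n) → 0.99 ≤ H t)
    (hout : ∀ t, 1 < |t| → H t ≤ 1 / (100 * n ^ p) / |t| ^ n)
    {g : ℝ → ℂ} (hg : Continuous g) {G : ℝ} (hG : G = ∫ y in (-1 : ℝ)..1, ‖g y‖ ^ 2)
    (hg₁ : ∀ t ∈ Set.Icc (-1 : ℝ) 1, ‖g t‖ ^ 2 ≤ n * (1 / 2 * G))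
    (hg₂ : ∀ t : ℝ, 1 < |t| → ‖g t‖ ^ 2 ≤ n ^ p * (1 / 2 * G) * |t| ^ n) :
    0.9 * G ≤ ∫ t in (-1 : ℝ)..1, ‖g t * (H t : ℂ)‖ ^ 2 ∧
    0.95 * ∫ t : ℝ, ‖g t * (H t : ℂ)‖ ^ 2 ≤ ∫ t in (-1 : ℝ)..1, ‖g t * (H t : ℂ)‖ ^ 2 := by
  have hn' : (2 : ℝ) ≤ n := by exact_mod_cast hn
  have hG0 : 0 ≤ G := by
    rw [hG]
    exact intervalIntegral.integral_nonneg (by norm_num) fun t _ => by positivity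
  have hF : Continuous fun t => ‖g t * (H t : ℂ)‖ ^ 2 := by fun_prop
  have hnorm : ∀ t, ‖g t * (H t : ℂ)‖ ^ 2 = ‖g t‖ ^ 2 * H t ^ 2 := fun t => by
    rw [norm_mul, mul_pow, Complex.norm_real, norm_eq_abs, sq_abs]
  have hr1 : (1 / (50 * n) : ℝ) ≤ 1 := by rw [div_le_one (by positivity)]; linarith
  have hlow : 0.96 * G ≤ ∫ t in (-1 : ℝ)..1, ‖g t * (H t : ℂ)‖ ^ 2 := by
    set r : ℝ := 1 / (50 * n) with hr
    have hr0 : 0 ≤ r := by positivity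
    have h1 := intervalIntegral_sub_le_of_le (F := fun t => ‖g t‖ ^ 2) (by fun_prop) hr0 hr1 hg₁
    rw [← hG] at h1
    have h2 : 2 * r * (n * (1 / 2 * G)) = 0.02 * G := by
      rw [hr]
      field_simp
      ring
    rw [h2] at h1
    calc 0.96 * G ≤ 0.98 * ∫ t in (-(1 - r))..(1 - r), ‖g t‖ ^ 2 := by linarith
      _ = ∫ t in (-(1 - r))..(1 - r), 0.98 * ‖g t‖ ^ 2 :=
          (intervalIntegral.integral_const_mul _ _).symm
      _ ≤ ∫ t in (-(1 - r))..(1 - r), ‖g t * (H t : ℂ)‖ ^ 2 := by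
          refine intervalIntegral.integral_mono_on (by linarith)
            (Continuous.intervalIntegrable (by fun_prop) _ _) (hF.intervalIntegrable _ _)
            fun t ht => ?_
          have h3 := hin t (abs_le.2 ht)
          rw [hnorm, mul_comm]
          gcongr
          nlinarith
      _ ≤ _ := intervalIntegral.integral_mono_interval (by linarith) (by linarith) (by linarith)
          (.of_forall fun t => by positivity) (hF.intervalIntegrable _ _)
  refine ⟨by linarith, ?_⟩
  have htail := integral_le_intervalIntegral_add hF (fun t => by positivity)
    (c := 1 / 10000 * G) (by positivity) fun t ht => by
      have ht0 : 0 < |t| := by linarith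
      have hnp : (1 : ℝ) ≤ n ^ p := one_le_pow₀ (by linarith)
      have ht2 : (|t| ^ n)⁻¹ ≤ 2 * (1 + t ^ 2)⁻¹ := by
        have h1 : |t| ^ 2 ≤ |t| ^ n := pow_le_pow_right₀ ht.le hn
        have h2 : 1 ≤ |t| ^ 2 := one_le_pow₀ ht.le
        rw [sq_abs] at h1 h2
        rw [inv_le_comm₀ (by positivity) (by positivity), mul_inv, inv_inv]
        linarith
      rw [hnorm]
      calc ‖g t‖ ^ 2 * H t ^ 2
          ≤ (n ^ p * (1 / 2 * G) * |t| ^ n) * (1 / (100 * n ^ p) / |t| ^ n) ^ 2 := by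
            gcongr
            · exact hg₂ t ht
            · exact h₀ t
            · exact hout t ht
        _ = 1 / 20000 * G * (n ^ p : ℝ)⁻¹ * (|t| ^ n)⁻¹ := by
            field_simp
            ring
        _ ≤ 1 / 20000 * G * 1 * (2 * (1 + t ^ 2)⁻¹) := by
            gcongr
            exact inv_le_one_of_one_le₀ hnp
        _ = _ := by ring
  have := mul_le_mul_of_nonneg_left pi_lt_d2.le hG0
  linarith

theorem ceil_mul_log_ceil_le {x : ℝ} (hx : 2 ≤ x) :
    (⌈x⌉₊ : ℝ) * log ⌈x⌉₊ ≤ 4 * (x * log x) := by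
  have h1 : (⌈x⌉₊ : ℝ) ≤ 2 * x := by
    have := Nat.ceil_lt_add_one (a := x) (by linarith)
    linarith
  have h0 : (0 : ℝ) < ⌈x⌉₊ := by
    have := Nat.le_ceil x
    linarith
  have h2 : log ⌈x⌉₊ ≤ 2 * log x := by
    calc log ⌈x⌉₊ ≤ log (x ^ 2) := log_le_log h0 (by nlinarith)
      _ = 2 * log x := by rw [log_pow]; norm_num
  have h3 : 0 ≤ log x := log_nonneg (by linarith)
  calc _ ≤ 2 * x * (2 * log x) := by gcongr
    _ = _ := by ring

/-- For every `a ≥ 1` there is `A = A(a)` such that for all `R, S ≥ 2`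
there is a bounded continuous integrable filter `H : ℝ → ℝ` with `|H| ≤ 1.01`, whose
Fourier transform is supported in `[−L, L]` for some `L ≤ A(R log R + S log S)`, and
which acts like a box on `[−1,1]` for every continuous `g` with
`sup_{[−1,1]} |g|² ≤ R‖g‖₂²` and `|g t|² ≤ R^a ‖g‖₂² |t|^S` for `|t| > 1`. -/
theorem filter_exists (a : ℝ) (ha : 1 ≤ a) :
    ∃ A : ℝ, 0 < A ∧
      ∀ R S : ℝ, 2 ≤ R → 2 ≤ S →
        ∃ H : ℝ → ℝ, Continuous H ∧ Integrable H ∧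
          (∀ x : ℝ, |H x| ≤ 1.01) ∧
          (∃ L : ℝ, L ≤ A * (R * Real.log R + S * Real.log S) ∧
            ∀ f : ℝ, L < |f| →
              (∫ t : ℝ, (H t : ℂ) *
                Complex.exp (-(2 * (Real.pi : ℂ) * Complex.I * (f : ℂ) * (t : ℂ)))) = 0) ∧
          (∀ g : ℝ → ℂ, Continuous g →
            (∀ t ∈ Set.Icc (-1 : ℝ) 1,
              ‖g t‖ ^ 2 ≤ R * ((1 / 2) * ∫ y in (-1 : ℝ)..1, ‖g y‖ ^ 2)) →
            (∀ t : ℝ, 1 < |t| →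
              ‖g t‖ ^ 2 ≤ R ^ a * ((1 / 2) * ∫ y in (-1 : ℝ)..1, ‖g y‖ ^ 2) * |t| ^ S) →
            (∫ t in (-1 : ℝ)..1, ‖g t * (H t : ℂ)‖ ^ 2) ≥
                0.9 * ∫ t in (-1 : ℝ)..1, ‖g t‖ ^ 2 ∧
            (∫ t in (-1 : ℝ)..1, ‖g t * (H t : ℂ)‖ ^ 2) ≥
                0.95 * ∫ t : ℝ, ‖g t * (H t : ℂ)‖ ^ 2) := by
  set p := ⌈a⌉₊ with hp
  have hap : a ≤ p := Nat.le_ceil a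
  refine ⟨8000 * (3 * p + 50), by positivity, fun R S hR hS => ?_⟩
  set M := max R S with hM
  have hM2 : 2 ≤ M := hR.trans (le_max_left _ _)
  set n := ⌈M⌉₊ with hn
  have hMn : M ≤ n := Nat.le_ceil M
  have hn' : (2 : ℝ) ≤ n := hM2.trans hMn
  have hn2 : 2 ≤ n := by exact_mod_cast hn'
  have hRn : R ≤ n := (le_max_left _ _).trans hMn
  have hSn : S ≤ n := (le_max_right _ _).trans hMn
  obtain ⟨K, hKc, hK0, hKi, hK1, hKt, hKf⟩ := exists_bandLimited_kernel p hn2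
  set δ : ℝ := 1 / (100 * n) with hδ
  have hδ1 : δ ≤ 1 := by rw [hδ, div_le_one (by positivity)]; linarith
  have hδ0 : 0 ≤ δ := by positivity
  have hw : 0 ≤ 1 - δ := by linarith
  have hH0 := boxAverage_nonneg hK0 hw
  refine ⟨boxAverage K (1 - δ), continuous_boxAverage hKc, integrable_boxAverage hKi hw,
    fun x => ?_, ⟨2000 * (3 * p + 50) * (n * log n), ?_, fun f hf => ?_⟩, fun g hg hg₁ hg₂ => ?_⟩
  · have := boxAverage_le_integral hKi hK0 hw x
    rw [abs_of_nonneg (hH0 x)]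
    linarith
  · have h1 := ceil_mul_log_ceil_le hM2
    rw [← hn] at h1
    have h2 : M * log M ≤ R * log R + S * log S := by
      have hR0 : 0 ≤ R * log R := mul_nonneg (by linarith) (log_nonneg (by linarith))
      have hS0 : 0 ≤ S * log S := mul_nonneg (by linarith) (log_nonneg (by linarith))
      rcases max_choice R S with h | h <;> rw [hM, h] <;> linarith
    calc _ ≤ 2000 * (3 * p + 50) * (4 * (R * log R + S * log S)) :=
          mul_le_mul_of_nonneg_left (by linarith) (by positivity)
      _ = _ := by ring
  · rw [← fourier_boxAverage_eq_zero hKi hw (hKf f hf), fourier_real_eq_integral_exp_smul]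
    refine integral_congr_ae (.of_forall fun t => ?_)
    simp only [smul_eq_mul]
    rw [mul_comm]
    congr 2
    push_cast
    ring
  · set G := ∫ y in (-1 : ℝ)..1, ‖g y‖ ^ 2 with hG
    have hG0 : 0 ≤ G := intervalIntegral.integral_nonneg (by norm_num) fun t _ => by positivity
    refine filter_bounds (p := p) hn2 (continuous_boxAverage hKc) hH0 (fun t ht => ?_)
      (fun t ht => ?_) hg hG (fun t ht => (hg₁ t ht).trans (by gcongr)) fun t ht => (hg₂ t ht).trans ?_
    · have hr : (1 : ℝ) / (50 * n) = 2 * δ := by rw [hδ]; field_simp; norm_num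
      have h1 := integral_sub_tail_le_boxAverage hKi hK0 hw (r := δ) (t := t) (by linarith)
      have h2 := hKt 0 le_rfl
      rw [zero_add, add_zero, one_pow, div_one] at h2
      have h3 : (1 : ℝ) / (100 * n ^ p) ≤ 1 / 100 := by
        gcongr
        have : (1 : ℝ) ≤ n ^ p := one_le_pow₀ (by linarith)
        linarith
      linarith
    · have h1 := hKt (|t| - 1) (by linarith)
      rw [add_sub_cancel] at h1
      exact (boxAverage_le_tail hKi hK0 hw (by linarith)).trans h1
    · rw [← rpow_natCast |t|, ← rpow_natCast (n : ℝ) p]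
      have h1 : R ^ a ≤ (n : ℝ) ^ (p : ℝ) :=
        (rpow_le_rpow (by linarith) hRn (by linarith)).trans
          (rpow_le_rpow_of_exponent_le (by linarith) hap)
      have h2 : |t| ^ S ≤ |t| ^ (n : ℝ) := rpow_le_rpow_of_exponent_le ht.le hSn
      gcongr
end

section
/- For every real x with 0 < |x| ≤ 1.2/π, one has 1 − π²·x²/6 ≤ sin(πx)/(πx) ≤ 1 − π²·x²/10. -/
open Real

theorem cos_le_one_sub_sq_add_pow_four {y : ℝ} (hy : 0 ≤ y) :
    Real.cos y ≤ 1 - y ^ 2 / 2 + y ^ 4 / 24 := by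
  let f (t : ℝ) : ℝ := 1 - t ^ 2 / 2 + t ^ 4 / 24 - Real.cos t
  have hderiv (t : ℝ) : deriv f t = Real.sin t - (t - t ^ 3 / 6) := by
    simp (disch := fun_prop) [f]
    ring
  have hmono : MonotoneOn f (Set.Ici 0) := by
    apply monotoneOn_of_deriv_nonneg (convex_Ici 0) (by fun_prop) (by fun_prop)
    intro t ht
    rw [hderiv]
    linarith [Real.sin_ge_sub_cube (interior_subset ht)]
  have h0 : f 0 ≤ f y := hmono (by simp) hy hy
  simp [f] at h0
  linarith

theorem sin_le_sub_cube_add_pow_five {y : ℝ} (hy : 0 ≤ y) :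
    Real.sin y ≤ y - y ^ 3 / 6 + y ^ 5 / 120 := by
  let f (t : ℝ) : ℝ := t - t ^ 3 / 6 + t ^ 5 / 120 - Real.sin t
  have hderiv (t : ℝ) : deriv f t = 1 - t ^ 2 / 2 + t ^ 4 / 24 - Real.cos t := by
    simp (disch := fun_prop) [f]
    ring
  have hmono : MonotoneOn f (Set.Ici 0) := by
    apply monotoneOn_of_deriv_nonneg (convex_Ici 0) (by fun_prop) (by fun_prop)
    intro t ht
    rw [hderiv]
    linarith [cos_le_one_sub_sq_add_pow_four (interior_subset ht)]
  have h0 : f 0 ≤ f y := hmono (by simp) hy hy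
  simp [f] at h0
  linarith

theorem sin_div_self_bounds {y : ℝ} (hy : 0 < y) (hy' : y ≤ 1.2) :
    1 - y ^ 2 / 6 ≤ Real.sin y / y ∧ Real.sin y / y ≤ 1 - y ^ 2 / 10 := by
  constructor
  · rw [le_div_iff₀ hy]
    linarith [Real.sin_ge_sub_cube hy.le]
  · rw [div_le_iff₀ hy]
    have hsq : y ^ 2 ≤ 8 := by norm_num at hy'; nlinarith
    nlinarith [sin_le_sub_cube_add_pow_five hy.le,
      mul_nonneg (pow_pos hy 3).le (sub_nonneg.2 hsq)]

/-- For every real `x` with `0 < |x| ≤ 1.2/π`,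
`1 − π²x²/6 ≤ sin(πx)/(πx) ≤ 1 − π²x²/10`. -/
theorem sinc_bounds (x : ℝ) (hx0 : 0 < |x|) (hx : |x| ≤ 1.2 / Real.pi) :
    1 - Real.pi ^ 2 * x ^ 2 / 6 ≤ Real.sin (Real.pi * x) / (Real.pi * x) ∧
      Real.sin (Real.pi * x) / (Real.pi * x) ≤ 1 - Real.pi ^ 2 * x ^ 2 / 10 := by
  have h := sin_div_self_bounds (mul_pos Real.pi_pos hx0)
    (by rwa [le_div_iff₀' Real.pi_pos] at hx)
  rw [mul_pow, sq_abs] at h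
  rcases abs_choice x with habs | habs <;> rw [habs] at h
  · exact h
  · simpa only [mul_neg, Real.sin_neg, neg_div_neg_eq] using h
end
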